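/- arXiv:2503.18196 — 2 statements merged into one kernel-verified Lean document; each statement's English description precedes it below -/
import Mathlib

section
/- If X is a locally connected continuum (compact connected metric space with more than one point) such that the hyperspace NC*(X) = {A ⊆ X : A nonempty closed connected and X \ A connected} is a closed subset of the hyperspace C(X) of subcontinua (with the Hausdorff metric), then X is homeomorphic to the unit interval [0,1] or to the unit circle. -/
open TopologicalSpace Set

open scoped Topology

section Topological

variable {X : Type*} [TopologicalSpace X]

theorem isPreconnected_iff_separated {s : Set X} :
    IsPreconnected s ↔ ∀ A B : Set X, A ∪ B = s → Disjoint (closure A) B →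
      Disjoint A (closure B) → A = ∅ ∨ B = ∅ := by
  rw [isPreconnected_iff_subset_of_disjoint]
  constructor
  · rintro h A B rfl hA hB
    have := h (closure B)ᶜ (closure A)ᶜ isClosed_closure.isOpen_compl isClosed_closure.isOpen_compl
      (union_subset_union hB.subset_compl_right hA.subset_compl_left) (by
        rw [← disjoint_iff_inter_eq_empty, ← compl_union, ← closure_union]
        exact disjoint_compl_right.mono_left (subset_closure.trans
          (closure_mono (union_comm A B).subset)))
    rcases this with h | h
    · right
      have h1 : B ⊆ (closure B)ᶜ := subset_union_right.trans h
      exact eq_empty_of_forall_notMem fun x hx => h1 hx (subset_closure hx)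
    · left
      have h1 : A ⊆ (closure A)ᶜ := subset_union_left.trans h
      exact eq_empty_of_forall_notMem fun x hx => h1 hx (subset_closure hx)
  · intro h u v hu hv hs huv
    have key : ∀ u v : Set X, IsOpen v → s ∩ (u ∩ v) = ∅ → Disjoint (closure (s ∩ u)) (s ∩ v) := by
      intro u v hv huv
      refine Disjoint.mono_right inter_subset_right ?_
      refine Disjoint.closure_left ?_ hv
      rw [disjoint_iff_inter_eq_empty, inter_assoc, huv]
    have := h (s ∩ u) (s ∩ v) (by rw [← inter_union_distrib_left, inter_eq_left.2 hs])
      (key u v hv huv) (key v u hu (by rwa [inter_comm v u])).symm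
    rcases this with h | h
    · right
      intro x hx
      rcases hs hx with h1 | h1
      · exact absurd (h ▸ ⟨hx, h1⟩ : x ∈ (∅ : Set X)) (notMem_empty x)
      · exact h1
    · left
      intro x hx
      rcases hs hx with h1 | h1
      · exact h1
      · exact absurd (h ▸ ⟨hx, h1⟩ : x ∈ (∅ : Set X)) (notMem_empty x)

theorem IsPreconnected.subset_or_subset_of_separated {s A B : Set X} (hs : IsPreconnected s)
    (hsub : s ⊆ A ∪ B) (hA : Disjoint (closure A) B) (hB : Disjoint A (closure B)) :
    s ⊆ A ∨ s ⊆ B := by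
  have := isPreconnected_iff_separated.1 hs (s ∩ A) (s ∩ B)
    (by rw [← inter_union_distrib_left, inter_eq_left.2 hsub])
    (hA.mono (closure_mono inter_subset_right) inter_subset_right)
    (hB.mono inter_subset_right (closure_mono inter_subset_right))
  rcases this with h | h
  · right
    intro x hx
    exact (hsub hx).resolve_left fun h1 => notMem_empty x (h ▸ ⟨hx, h1⟩)
  · left
    intro x hx
    exact (hsub hx).resolve_right fun h1 => notMem_empty x (h ▸ ⟨hx, h1⟩)

theorem IsPreconnected.union_of_separated_compl [PreconnectedSpace X] {C M N : Set X}
    (hC : IsPreconnected C) (hMN : M ∪ N = Cᶜ) (hM : Disjoint (closure M) N)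
    (hN : Disjoint M (closure N)) : IsPreconnected (C ∪ N) := by
  have key : ∀ A B : Set X, A ∪ B = C ∪ N → Disjoint (closure A) B →
      Disjoint A (closure B) → C ⊆ A → A = ∅ ∨ B = ∅ := by
    intro A B hAB hA hB hCA
    have hBN : B ⊆ N := fun x hx => (hAB.subset (Or.inr hx)).resolve_left fun h =>
      disjoint_left.1 hA (subset_closure (hCA h)) hx
    have := isPreconnected_iff_separated.1 (isPreconnected_univ (α := X)) (A ∪ M) B
      (by rw [union_right_comm, hAB, union_assoc, union_comm N M, hMN, union_compl_self])
      (by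
        rw [closure_union, disjoint_union_left]
        exact ⟨hA, hM.mono_right hBN⟩)
      (by
        rw [disjoint_union_left]
        exact ⟨hB, hN.mono_right (closure_mono hBN)⟩)
    exact this.imp_left fun h => (union_empty_iff.1 h).1
  rw [isPreconnected_iff_separated]
  intro A B hAB hA hB
  rcases hC.subset_or_subset_of_separated (hAB ▸ subset_union_left) hA hB with h | h
  · exact key A B hAB hA hB h
  · exact (key B A (by rw [union_comm, hAB]) hB.symm hA.symm h).symm

theorem isPreconnected_compl_connectedComponentIn [PreconnectedSpace X] {V : Set X}
    (hV : IsPreconnected V) (c : X) : IsPreconnected (connectedComponentIn Vᶜ c)ᶜ := by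
  by_cases hc : c ∈ Vᶜ
  swap
  · rw [connectedComponentIn_eq_empty hc, compl_empty]
    exact isPreconnected_univ
  set C := connectedComponentIn Vᶜ c with hCdef
  have hVC : V ⊆ Cᶜ := subset_compl_comm.1 (connectedComponentIn_subset _ _)
  have key : ∀ M N : Set X, M ∪ N = Cᶜ → Disjoint (closure M) N → Disjoint M (closure N) →
      V ⊆ M → N = ∅ := by
    intro M N hMN hM hN hVM
    have hconn : IsPreconnected (C ∪ N) :=
      isPreconnected_connectedComponentIn.union_of_separated_compl hMN hM hN
    have hNV : N ⊆ Vᶜ := fun x hx hxV => disjoint_left.1 hM (subset_closure (hVM hxV)) hx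
    have : C ∪ N ⊆ C := hconn.subset_connectedComponentIn
      (Or.inl (mem_connectedComponentIn hc)) (union_subset (connectedComponentIn_subset _ _) hNV)
    exact eq_empty_of_forall_notMem fun x hx =>
      hMN.subset (Or.inr hx) (this (Or.inr hx))
  rw [isPreconnected_iff_separated]
  intro M N hMN hM hN
  rcases hV.subset_or_subset_of_separated (hMN ▸ hVC) hM hN with h | h
  · exact Or.inr (key M N hMN hM hN h)
  · exact Or.inl (key N M (by rw [union_comm, hMN]) hN.symm hM.symm h)

theorem isPreconnected_sInter_of_directedOn [T2Space X] {c : Set (Set X)} (hne : c.Nonempty)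
    (hc : DirectedOn (fun s t => t ⊆ s) c) (hcomp : ∀ s ∈ c, IsCompact s)
    (hconn : ∀ s ∈ c, IsPreconnected s) : IsPreconnected (⋂₀ c) := by
  have hclosed : IsClosed (⋂₀ c) := isClosed_sInter fun s hs => (hcomp s hs).isClosed
  have hcompact : IsCompact (⋂₀ c) := by
    obtain ⟨s, hs⟩ := hne
    exact (hcomp s hs).of_isClosed_subset hclosed (sInter_subset_of_mem hs)
  rw [isPreconnected_iff_subset_of_fully_disjoint_closed hclosed]
  intro u v hu hv hsub huv
  obtain ⟨U, V, hU, hV, hUs, hVs, hUV⟩ := SeparatedNhds.of_isCompact_isCompact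
    (hcompact.inter_right hu) (hcompact.inter_right hv)
    (huv.mono inter_subset_right inter_subset_right)
  have hsubUV : ⋂₀ c ⊆ U ∪ V := fun x hx =>
    (hsub hx).imp (fun h => hUs ⟨hx, h⟩) (fun h => hVs ⟨hx, h⟩)
  obtain ⟨⟨s, hs⟩, hsUV⟩ : ∃ i : c, (i : Set X) ⊆ U ∪ V := by
    have := hne.to_subtype
    refine exists_subset_nhds_of_isCompact (ι := c) (V := fun i => (i : Set X))
      (fun a b => ?_) (fun i => hcomp i i.2) (U := U ∪ V) ?_
    · obtain ⟨d, hd, h1, h2⟩ := hc a a.2 b b.2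
      exact ⟨⟨d, hd⟩, h1, h2⟩
    · intro x hx
      exact (hU.union hV).mem_nhds (hsubUV (by rwa [sInter_eq_iInter]))
  have hcs : ⋂₀ c ⊆ s := sInter_subset_of_mem hs
  rcases (hconn s hs).subset_or_subset hU hV hUV hsUV with h | h
  · left
    exact fun x hx => (hsub hx).resolve_right fun hxv =>
      disjoint_left.1 hUV (h (hcs hx)) (hVs ⟨hx, hxv⟩)
  · right
    exact fun x hx => (hsub hx).resolve_left fun hxu =>
      disjoint_left.1 hUV (hUs ⟨hx, hxu⟩) (h (hcs hx))

theorem exists_isOpen_isConnected_mem_closure_subset [RegularSpace X] [LocallyConnectedSpace X]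
    {x : X} {U : Set X} (hU : U ∈ 𝓝 x) :
    ∃ W, IsOpen W ∧ x ∈ W ∧ IsPreconnected W ∧ closure W ⊆ U := by
  obtain ⟨t, ht, htc, htU⟩ := exists_mem_nhds_isClosed_subset hU
  obtain ⟨W, hWt, hW, hxW, hWc⟩ := locallyConnectedSpace_iff_subsets_isOpen_isConnected.1
    ‹_› x t ht
  exact ⟨W, hW, hxW, hWc.isPreconnected, (closure_minimal hWt htc).trans htU⟩

theorem IsPreconnected.exists_isOpen_isPreconnected_closure_subset [RegularSpace X]
    [LocallyConnectedSpace X] {U K : Set X} (hU : IsOpen U) (hconn : IsPreconnected U)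
    (hne : U.Nonempty) (hK : IsCompact K) (hKU : K ⊆ U) :
    ∃ V, IsOpen V ∧ IsPreconnected V ∧ V.Nonempty ∧ K ⊆ V ∧ closure V ⊆ U := by
  obtain ⟨x₀, hx₀⟩ := hne
  have hN : ∀ x ∈ U, ∃ W, IsOpen W ∧ x ∈ W ∧ IsPreconnected W ∧ closure W ⊆ U := fun x hx =>
    exists_isOpen_isConnected_mem_closure_subset (hU.mem_nhds hx)
  set T : Set X := {x | ∃ V, IsOpen V ∧ IsPreconnected V ∧ x₀ ∈ V ∧ x ∈ V ∧ closure V ⊆ U}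
  have hunion : ∀ V W : Set X, (IsOpen V ∧ IsPreconnected V ∧ closure V ⊆ U) →
      (IsOpen W ∧ IsPreconnected W ∧ closure W ⊆ U) → (V ∩ W).Nonempty →
      (IsOpen (V ∪ W) ∧ IsPreconnected (V ∪ W) ∧ closure (V ∪ W) ⊆ U) :=
    fun V W hV hW hVW => ⟨hV.1.union hW.1, hV.2.1.union' hVW hW.2.1, by
      rw [closure_union]; exact union_subset hV.2.2 hW.2.2⟩
  have hTopen : IsOpen T := by
    rw [isOpen_iff_mem_nhds]
    rintro x ⟨V, hV, hVc, h0, hx, hVU⟩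
    exact Filter.mem_of_superset (hV.mem_nhds hx) fun y hy => ⟨V, hV, hVc, h0, hy, hVU⟩
  have hTclosed : IsOpen (U \ T) := by
    rw [isOpen_iff_mem_nhds]
    rintro x ⟨hxU, hxT⟩
    obtain ⟨W, hW, hxW, hWc, hWU⟩ := hN x hxU
    refine Filter.mem_of_superset (hW.mem_nhds hxW) fun y hy =>
      ⟨hWU (subset_closure hy), fun ⟨V, hV, hVc, h0, hyV, hVU⟩ => hxT ?_⟩
    obtain ⟨h1, h2, h3⟩ := hunion V W ⟨hV, hVc, hVU⟩ ⟨hW, hWc, hWU⟩ ⟨y, hyV, hy⟩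
    exact ⟨V ∪ W, h1, h2, Or.inl h0, Or.inr hxW, h3⟩
  have hUT : U ⊆ T := by
    refine hconn.subset_left_of_subset_union hTopen hTclosed disjoint_sdiff_right ?_ ?_
    · intro x hx
      by_cases h : x ∈ T
      · exact Or.inl h
      · exact Or.inr ⟨hx, h⟩
    · obtain ⟨W, hW, hxW, hWc, hWU⟩ := hN x₀ hx₀
      exact ⟨x₀, hx₀, W, hW, hWc, hxW, hxW, hWU⟩
  have : ∃ V, IsOpen V ∧ IsPreconnected V ∧ x₀ ∈ V ∧ K ⊆ V ∧ closure V ⊆ U := by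
    refine hK.induction_on
      (p := fun s => ∃ V, IsOpen V ∧ IsPreconnected V ∧ x₀ ∈ V ∧ s ⊆ V ∧ closure V ⊆ U)
      ?_ ?_ ?_ ?_
    · obtain ⟨W, hW, hxW, hWc, hWU⟩ := hN x₀ hx₀
      exact ⟨W, hW, hWc, hxW, empty_subset _, hWU⟩
    · rintro s t hst ⟨V, h1, h2, h3, h4, h5⟩
      exact ⟨V, h1, h2, h3, hst.trans h4, h5⟩
    · rintro s t ⟨V, h1, h2, h3, h4, h5⟩ ⟨W, k1, k2, k3, k4, k5⟩
      obtain ⟨j1, j2, j3⟩ := hunion V W ⟨h1, h2, h5⟩ ⟨k1, k2, k5⟩ ⟨x₀, h3, k3⟩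
      exact ⟨V ∪ W, j1, j2, Or.inl h3, union_subset_union h4 k4, j3⟩
    · intro x hx
      obtain ⟨V, h1, h2, h3, h4, h5⟩ := hUT (hKU hx)
      exact ⟨V, mem_nhdsWithin_of_mem_nhds (h1.mem_nhds h4), V, h1, h2, h3, subset_rfl, h5⟩
  obtain ⟨V, h1, h2, h3, h4, h5⟩ := this
  exact ⟨V, h1, h2, ⟨x₀, h3⟩, h4, h5⟩

end Topological

section InitialSegment

variable {X : Type*}

theorem closure_connectedComponentIn_compl_singleton_subset [TopologicalSpace X] [T1Space X]
    [LocallyConnectedSpace X] (c a : X) : closure (connectedComponentIn ({c}ᶜ : Set X) a) ⊆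
      insert c (connectedComponentIn ({c}ᶜ : Set X) a) := by
  intro z hz
  by_cases hzc : z = c
  · exact Or.inl hzc
  · obtain ⟨w, hwz, hwa⟩ := mem_closure_iff.1 hz _
      (isOpen_compl_singleton.connectedComponentIn (x := z)) (mem_connectedComponentIn hzc)
    rw [connectedComponentIn_eq hwa, ← connectedComponentIn_eq hwz]
    exact Or.inr (mem_connectedComponentIn hzc)

/-- The component of `p` in the complement of `x`, together with `x` itself. -/
def initialSegment [TopologicalSpace X] (p x : X) : Set X :=
  insert x (connectedComponentIn ({x}ᶜ : Set X) p)

theorem mem_initialSegment_self [TopologicalSpace X] (p x : X) : x ∈ initialSegment p x :=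
  mem_insert _ _

theorem initialSegment_nonempty [TopologicalSpace X] (p x : X) : (initialSegment p x).Nonempty :=
  ⟨x, mem_initialSegment_self p x⟩

theorem left_mem_initialSegment [TopologicalSpace X] (p x : X) : p ∈ initialSegment p x := by
  by_cases h : p = x
  · exact Or.inl h
  · exact Or.inr (mem_connectedComponentIn h)

theorem initialSegment_left [TopologicalSpace X] (p : X) : initialSegment p p = {p} := by
  rw [initialSegment, connectedComponentIn_eq_empty (by simp)]
  simp

section LocallyConnected

variable [TopologicalSpace X] [T1Space X] [LocallyConnectedSpace X] {p q : X}

theorem isClosed_initialSegment (p x : X) : IsClosed (initialSegment p x) := by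
  refine isClosed_of_closure_subset ?_
  rw [initialSegment, insert_eq, closure_union, closure_singleton]
  exact union_subset (subset_union_left)
    (closure_connectedComponentIn_compl_singleton_subset x p)

variable [ConnectedSpace X]

theorem isPreconnected_initialSegment (p x : X) : IsPreconnected (initialSegment p x) := by
  rcases eq_or_ne p x with rfl | h
  · rw [initialSegment_left]
    exact isPreconnected_singleton
  have hp : p ∈ connectedComponentIn ({x}ᶜ : Set X) p := mem_connectedComponentIn h
  suffices x ∈ closure (connectedComponentIn ({x}ᶜ : Set X) p) from
    isPreconnected_connectedComponentIn.subset_closure (subset_insert _ _)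
      (insert_subset this subset_closure)
  by_contra hx
  have hcl : IsClosed (connectedComponentIn ({x}ᶜ : Set X) p) :=
    isClosed_of_closure_subset fun z hz =>
      (closure_connectedComponentIn_compl_singleton_subset x p hz).resolve_left fun h => hx (h ▸ hz)
  have := IsClopen.eq_univ ⟨hcl, isOpen_compl_singleton.connectedComponentIn⟩ ⟨p, hp⟩
  exact hx (subset_closure (this ▸ mem_univ x))

theorem initialSegment_subset_of_notMem {x z : X} (hz : z ∉ initialSegment p x) :
    initialSegment p x ⊆ connectedComponentIn ({z}ᶜ : Set X) p :=
  (isPreconnected_initialSegment p x).subset_connectedComponentIn (left_mem_initialSegment p x)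
    (subset_compl_singleton_iff.2 hz)

theorem notMem_initialSegment_of_mem
    (hsep : ∀ x : X, q ∉ connectedComponentIn ({x}ᶜ : Set X) p) {a b : X}
    (hab : a ∈ connectedComponentIn ({b}ᶜ : Set X) p) : b ∉ initialSegment p a := by
  have hne : a ≠ b := connectedComponentIn_subset _ _ hab
  rintro (h | hba)
  · exact hne h.symm
  have hqa : q ≠ a := fun h => hsep b (h ▸ hab)
  have hbQ : b ∉ initialSegment q a := by
    rintro (h | h)
    · exact hne h.symm
    · apply hsep a
      rw [connectedComponentIn_eq hba, ← connectedComponentIn_eq h]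
      exact mem_connectedComponentIn hqa
  have hsub := (isPreconnected_initialSegment q a).subset_connectedComponentIn
    (mem_initialSegment_self q a) (subset_compl_singleton_iff.2 hbQ)
  rw [← connectedComponentIn_eq hab] at hsub
  exact hsep b (hsub (left_mem_initialSegment q a))

theorem initialSegment_right (hsep : ∀ x : X, q ∉ connectedComponentIn ({x}ᶜ : Set X) p) :
    initialSegment p q = univ := by
  refine eq_univ_of_forall fun z => ?_
  by_contra hz
  exact hsep z (initialSegment_subset_of_notMem hz (mem_initialSegment_self p q))

theorem initialSegment_subset_union
    (hsep : ∀ x : X, q ∉ connectedComponentIn ({x}ᶜ : Set X) p) {x y : X} {W : Set X}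
    (hW : IsPreconnected W) (hx : x ∈ W) (hy : y ∈ W) :
    initialSegment p y ⊆ initialSegment p x ∪ W := by
  intro z hz
  by_contra! h
  obtain ⟨hzx, hzW⟩ := not_or.1 h
  have hxz := initialSegment_subset_of_notMem hzx (mem_initialSegment_self p x)
  have hWz := hW.subset_connectedComponentIn hx (subset_compl_singleton_iff.2 hzW)
  rw [← connectedComponentIn_eq hxz] at hWz
  exact notMem_initialSegment_of_mem hsep (hWz hy) hz

end LocallyConnected

section Metric

variable [MetricSpace X] [ConnectedSpace X] [LocallyConnectedSpace X] {p q : X}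

theorem continuous_infDist_initialSegment
    (hsep : ∀ x : X, q ∉ connectedComponentIn ({x}ᶜ : Set X) p) (d : X) :
    Continuous fun x => Metric.infDist d (initialSegment p x) := by
  have key : ∀ (W : Set X) (ε : ℝ) (x y : X), IsPreconnected W →
      (∀ a ∈ W, ∀ b ∈ W, dist a b < ε) → x ∈ W → y ∈ W →
      Metric.infDist d (initialSegment p x) - ε ≤ Metric.infDist d (initialSegment p y) := by
    intro W ε x y hW hdiam hx hy
    rw [Metric.le_infDist (initialSegment_nonempty p y)]
    intro z hz
    rcases initialSegment_subset_union hsep hW hx hy hz with h | h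
    · have := Metric.infDist_le_dist_of_mem (x := d) h
      have := (dist_nonneg (x := x) (y := x)).trans_lt (hdiam x hx x hx)
      linarith
    · have h1 := Metric.infDist_le_dist_of_mem (x := d) (mem_initialSegment_self p x)
      have h2 := dist_triangle d z x
      have h3 := hdiam z h x hx
      linarith
  rw [Metric.continuous_iff']
  intro x ε hε
  obtain ⟨W, hW, hxW, hWc, hWsub⟩ := exists_isOpen_isConnected_mem_closure_subset
    (Metric.ball_mem_nhds x (show 0 < ε / 4 by linarith))
  have hdiam : ∀ a ∈ W, ∀ b ∈ W, dist a b < ε / 2 := fun a ha b hb => by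
    have h1 := Metric.mem_ball.1 (hWsub (subset_closure ha))
    have h2 := Metric.mem_ball.1 (hWsub (subset_closure hb))
    have := dist_triangle_right a b x
    linarith
  filter_upwards [hW.mem_nhds hxW] with y hy
  have h1 := key W _ x y hWc hdiam hxW hy
  have h2 := key W _ y x hWc hdiam hy hxW
  rw [Real.dist_eq, abs_lt]
  constructor <;> linarith

variable [CompactSpace X]

/-- A locally connected continuum in which every point separates `p` from `q` is an arc with
end points `p` and `q`. -/
theorem exists_homeomorph_unitInterval (hpq : p ≠ q)
    (hsep : ∀ x : X, q ∉ connectedComponentIn ({x}ᶜ : Set X) p) :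
    ∃ f : X ≃ₜ unitInterval, f p = 0 ∧ f q = 1 := by
  let w : ℕ → X → ℝ := fun n x => (1 / 2) ^ n * Metric.infDist (denseSeq X n) (initialSegment p x)
  have hw0 : ∀ n x, 0 ≤ w n x := fun n x => mul_nonneg (by positivity) Metric.infDist_nonneg
  have hwle : ∀ n x, w n x ≤ (1 / 2) ^ n * Metric.diam (univ : Set X) := fun n x =>
    mul_le_mul_of_nonneg_left ((Metric.infDist_le_dist_of_mem (mem_initialSegment_self p x)).trans
      (Metric.dist_le_diam_of_mem isCompact_univ.isBounded (mem_univ _) (mem_univ _)))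
      (by positivity)
  have hbound : Summable fun n : ℕ => (1 / 2 : ℝ) ^ n * Metric.diam (univ : Set X) :=
    summable_geometric_two.mul_right _
  have hsum : ∀ x, Summable fun n => w n x := fun x =>
    hbound.of_nonneg_of_le (fun n => hw0 n x) fun n => hwle n x
  let g : X → ℝ := fun x => ∑' n, w n x
  have hgcont : Continuous g :=
    continuous_tsum (fun n => (continuous_infDist_initialSegment hsep _).const_mul _) hbound
      fun n x => by rw [Real.norm_of_nonneg (hw0 n x)]; exact hwle n x
  have hwmono : ∀ x y, initialSegment p x ⊆ initialSegment p y → ∀ n, w n y ≤ w n x :=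
    fun x y hxy n => mul_le_mul_of_nonneg_left
      (Metric.infDist_le_infDist_of_subset hxy (initialSegment_nonempty p x)) (by positivity)
  have hgq : g q = 0 := by
    simp [g, w, initialSegment_right hsep, Metric.infDist_zero_of_mem]
  have hg0 : ∀ x, 0 ≤ g x := fun x => tsum_nonneg fun n => hw0 n x
  have hgp : ∀ x, g x ≤ g p := fun x => (hsum x).tsum_le_tsum (hwmono p x (by
    rw [initialSegment_left]
    exact singleton_subset_iff.2 (left_mem_initialSegment p x))) (hsum p)
  have hanti : ∀ x y, x ∈ connectedComponentIn ({y}ᶜ : Set X) p → g y < g x := by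
    intro x y hxy
    have hy := notMem_initialSegment_of_mem hsep hxy
    have hδ := ((isClosed_initialSegment p x).notMem_iff_infDist_pos
      (initialSegment_nonempty p x)).1 hy
    obtain ⟨n, hn⟩ := (denseRange_denseSeq X).exists_dist_lt y (half_pos hδ)
    refine Summable.tsum_lt_tsum (i := n) (hwmono x y ((initialSegment_subset_of_notMem hy).trans
      (subset_insert _ _))) ?_ (hsum y) (hsum x)
    refine mul_lt_mul_of_pos_left ?_ (by positivity)
    have h1 := Metric.infDist_le_dist_of_mem (x := denseSeq X n) (mem_initialSegment_self p y)
    have h2 := Metric.infDist_le_infDist_add_dist (s := initialSegment p x) (x := y)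
      (y := denseSeq X n)
    rw [dist_comm] at h1
    linarith
  have hinj : Function.Injective g := by
    intro x y hxy
    by_contra hne
    by_cases h : x ∈ initialSegment p y
    · exact (hanti x y (h.resolve_left hne)).ne' hxy
    · exact (hanti y x (initialSegment_subset_of_notMem h (mem_initialSegment_self p y))).ne hxy
  have hpos : 0 < g p := (hg0 p).lt_of_ne fun h => hpq (hinj (h.symm.trans hgq.symm))
  let f : X → unitInterval := fun x => ⟨1 - g x / g p, by
    have := div_le_one_of_le₀ (hgp x) hpos.le
    have := div_nonneg (hg0 x) hpos.le
    constructor <;> linarith⟩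
  have hf : Continuous f := by fun_prop
  have hfp : f p = 0 := Subtype.ext (by simp [f, hpos.ne'])
  have hfq : f q = 1 := Subtype.ext (by simp [f, hgq])
  have hbij : Function.Bijective f := by
    constructor
    · intro x y hxy
      have := congrArg Subtype.val hxy
      simp only [f, sub_right_inj, div_left_inj' hpos.ne'] at this
      exact hinj this
    · intro t
      have := isPreconnected_univ.intermediate_value (mem_univ p) (mem_univ q) hf.continuousOn
      rw [hfp, hfq] at this
      obtain ⟨x, -, hx⟩ := this ⟨unitInterval.nonneg', unitInterval.le_one'⟩
      exact ⟨x, hx⟩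
  exact ⟨hf.homeoOfEquivCompactToT2 (f := Equiv.ofBijective f hbij), hfp, hfq⟩

end Metric

end InitialSegment


/-- A nonempty closed connected set whose complement is connected. -/
structure IsNonseparating {X : Type*} [TopologicalSpace X] (A : Set X) : Prop where
  isClosed : IsClosed A
  nonempty : A.Nonempty
  isPreconnected : IsPreconnected A
  isPreconnected_compl : IsPreconnected Aᶜ

theorem isPreconnected_compl_of_approx {X : Type*} [MetricSpace X] [CompactSpace X]
    (h : IsClosed {A : {A : NonemptyCompacts X // IsConnected (A : Set X)} |
        IsPreconnected ((A.1 : Set X)ᶜ)})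
    {B : Set X} (hB : IsClosed B) (hBne : B.Nonempty) (hBconn : IsPreconnected B)
    (happrox : ∀ ε > 0, ∃ A, IsNonseparating A ∧ A ⊆ B ∧ ∀ x ∈ B, ∃ y ∈ A, dist x y ≤ ε) :
    IsPreconnected Bᶜ := by
  let toHyper (A : Set X) (h1 : IsClosed A) (h2 : A.Nonempty) (h3 : IsPreconnected A) :
      {A : NonemptyCompacts X // IsConnected (A : Set X)} :=
    ⟨⟨⟨A, h1.isCompact⟩, h2⟩, h2, h3⟩
  suffices toHyper B hB hBne hBconn ∈ {A : {A : NonemptyCompacts X // IsConnected (A : Set X)} |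
        IsPreconnected ((A.1 : Set X)ᶜ)} from this
  rw [← h.closure_eq, Metric.mem_closure_iff]
  intro ε hε
  obtain ⟨A, hA, hAB, hdist⟩ := happrox (ε / 2) (half_pos hε)
  refine ⟨toHyper A hA.isClosed hA.nonempty hA.isPreconnected, hA.isPreconnected_compl, ?_⟩
  rw [Subtype.dist_eq, Metric.NonemptyCompacts.dist_eq]
  refine (Metric.hausdorffDist_le_of_mem_dist (half_pos hε).le hdist fun x hx =>
    ⟨x, hAB hx, by simpa using (half_pos hε).le⟩).trans_lt (half_lt_self hε)

theorem IsNonseparating.exists_minimal {X : Type*} [TopologicalSpace X] [T2Space X]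
    [CompactSpace X] {A Z : Set X} (hA : IsNonseparating A) (hZ : Z ⊆ A) :
    ∃ F, IsNonseparating F ∧ Z ⊆ F ∧ F ⊆ A ∧
      ∀ G, IsNonseparating G → Z ⊆ G → G ⊆ F → G = F := by
  obtain ⟨F, hFA, hF⟩ := zorn_superset_nonempty {F | IsNonseparating F ∧ Z ⊆ F} (by
    intro c hc hchain hne
    have hdir : DirectedOn (fun s t => t ⊆ s) c := by
      intro a ha b hb
      rcases hchain.total ha hb with h | h
      · exact ⟨a, ha, subset_rfl, h⟩
      · exact ⟨b, hb, h, subset_rfl⟩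
    refine ⟨⋂₀ c, ⟨⟨?_, ?_, ?_, ?_⟩, subset_sInter fun s hs => (hc hs).2⟩,
      fun s hs => sInter_subset_of_mem hs⟩
    · exact isClosed_sInter fun s hs => (hc hs).1.isClosed
    · have := hne.to_subtype
      rw [sInter_eq_iInter]
      refine IsCompact.nonempty_iInter_of_directed_nonempty_isCompact_isClosed _ ?_
        (fun i => (hc i.2).1.nonempty) (fun i => (hc i.2).1.isClosed.isCompact)
        (fun i => (hc i.2).1.isClosed)
      rintro ⟨a, ha⟩ ⟨b, hb⟩
      obtain ⟨d, hd, h1, h2⟩ := hdir a ha b hb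
      exact ⟨⟨d, hd⟩, h1, h2⟩
    · exact isPreconnected_sInter_of_directedOn hne hdir
        (fun s hs => (hc hs).1.isClosed.isCompact) (fun s hs => (hc hs).1.isPreconnected)
    · rw [compl_sInter]
      refine IsPreconnected.sUnion_directed ?_ ?_
      · rintro _ ⟨a, ha, rfl⟩ _ ⟨b, hb, rfl⟩
        obtain ⟨d, hd, h1, h2⟩ := hdir a ha b hb
        exact ⟨dᶜ, ⟨d, hd, rfl⟩, compl_subset_compl.2 h1, compl_subset_compl.2 h2⟩
      · rintro _ ⟨a, ha, rfl⟩
        exact (hc ha).1.isPreconnected_compl) A ⟨hA, hZ⟩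
  exact ⟨F, hF.prop.1, hF.prop.2, hFA, fun G hG hZG hGF => (hF.eq_of_superset ⟨hG, hZG⟩ hGF).symm⟩

theorem IsClosed.connectedComponentIn' {X : Type*} [TopologicalSpace X] {Z : Set X}
    (hZ : IsClosed Z) (a : X) :
    IsClosed (connectedComponentIn Z a) := by
  by_cases ha : a ∈ Z
  · exact isClosed_of_closure_subset
      (isPreconnected_connectedComponentIn.closure.subset_connectedComponentIn
        (subset_closure (mem_connectedComponentIn ha))
        (closure_minimal (connectedComponentIn_subset _ _) hZ))
  · rw [connectedComponentIn_eq_empty ha]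
    exact isClosed_empty

/-- Removing a connected open set that touches the complement of a nonseparating set leaves
nonseparating components. -/
theorem IsNonseparating.component_diff {X : Type*} [TopologicalSpace X] [PreconnectedSpace X]
    {F W : Set X} (hF : IsNonseparating F) (hW : IsOpen W)
    (hWc : IsPreconnected W) (hFW : F = univ ∨ (Fᶜ ∩ W).Nonempty) {a : X} (ha : a ∈ F \ W) :
    IsNonseparating (connectedComponentIn (F \ W) a) := by
  have heq : F \ W = (Fᶜ ∪ W)ᶜ := by rw [compl_union, compl_compl, sdiff_eq]
  have hV : IsPreconnected (Fᶜ ∪ W) := by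
    rcases hFW with rfl | h
    · simpa using hWc
    · exact hF.isPreconnected_compl.union' h hWc
  refine ⟨?_, ⟨a, mem_connectedComponentIn ha⟩, isPreconnected_connectedComponentIn, ?_⟩
  · exact (hF.isClosed.sdiff hW).connectedComponentIn' a
  · rw [heq]
    exact isPreconnected_compl_connectedComponentIn hV a


theorem isNonseparating_univ {X : Type*} [TopologicalSpace X] [ConnectedSpace X] :
    IsNonseparating (univ : Set X) :=
  ⟨isClosed_univ, univ_nonempty, isPreconnected_univ, by simpa using isPreconnected_empty⟩

/-- A nonseparating set that is minimal around `Z` has no frontier points, apart from points of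
`Z`, that can be avoided by a continuum in it which links up `Z`. -/
theorem IsNonseparating.mem_of_minimal {X : Type*} [TopologicalSpace X] [RegularSpace X]
    [PreconnectedSpace X] [LocallyConnectedSpace X] {F Z K : Set X}
    (hF : IsNonseparating F)
    (hmin : ∀ G, IsNonseparating G → Z ⊆ G → G ⊆ F → G = F) (hKF : K ⊆ F) (hZF : Z ⊆ F)
    (hZ : IsClosed Z) (hK : IsClosed K) (hKZ : IsPreconnected (K ∪ Z)) (hne : Z.Nonempty) {y : X}
    (hy : y ∈ F) (hyK : y ∉ K) (hyF : F = univ ∨ y ∈ closure Fᶜ) : y ∈ Z := by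
  by_contra hyZ
  obtain ⟨W, hW, hyW, hWc, hWsub⟩ := exists_isOpen_isConnected_mem_closure_subset
    ((hK.union hZ).isOpen_compl.mem_nhds (show y ∈ (K ∪ Z)ᶜ from fun h => h.elim hyK hyZ))
  have hWsub : K ∪ Z ⊆ Wᶜ := subset_compl_comm.1 (subset_closure.trans hWsub)
  obtain ⟨a, ha⟩ := hne
  have haW : a ∉ W := hWsub (Or.inr ha)
  have hG := hF.component_diff hW hWc (hyF.imp_right fun h => by
    rw [inter_comm]; exact mem_closure_iff.1 h W hW hyW) ⟨hZF ha, haW⟩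
  have hsub := connectedComponentIn_subset (F \ W) a
  have hKZsub : K ∪ Z ⊆ connectedComponentIn (F \ W) a :=
    hKZ.subset_connectedComponentIn (Or.inr ha)
      fun x hx => ⟨union_subset hKF hZF hx, hWsub hx⟩
  have := hmin _ hG (subset_union_right.trans hKZsub) (hsub.trans sdiff_subset)
  exact (hsub (this.symm.subset hy)).2 hyW

section Continuum

variable {X : Type*} [MetricSpace X] [CompactSpace X] [PreconnectedSpace X]
  [LocallyConnectedSpace X]

theorem isPreconnected_compl_closure_of_isClosed
    (h : IsClosed {A : {A : NonemptyCompacts X // IsConnected (A : Set X)} |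
        IsPreconnected ((A.1 : Set X)ᶜ)})
    (S : Set X) (hS : IsOpen S) (hSc : IsPreconnected S) (hSc' : IsPreconnected Sᶜ) :
    IsPreconnected (closure S)ᶜ := by
  rcases S.eq_empty_or_nonempty with rfl | hne
  · simpa using isPreconnected_univ
  rcases Sᶜ.eq_empty_or_nonempty with hc | ⟨c, hc⟩
  · rw [compl_empty_iff.1 hc]
    simpa using isPreconnected_empty
  refine isPreconnected_compl_of_approx h isClosed_closure hne.closure hSc.closure fun ε hε => ?_
  obtain ⟨t, htS, htfin, ht⟩ := Metric.finite_approx_of_totallyBounded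
    ((isCompact_univ (X := X)).totallyBounded.subset (subset_univ S)) ε hε
  obtain ⟨V, hV, hVc, hVne, htV, hVS⟩ := hSc.exists_isOpen_isPreconnected_closure_subset hS hne
    htfin.isCompact htS
  have hScV : Sᶜ ⊆ (closure V)ᶜ := compl_subset_compl.2 hVS
  set O := connectedComponentIn (closure V)ᶜ c with hO
  have hSO : Sᶜ ⊆ O := hSc'.subset_connectedComponentIn hc hScV
  have hVO : closure V ⊆ Oᶜ := subset_compl_comm.1 (connectedComponentIn_subset _ _)
  have hOS : Oᶜ ⊆ S := compl_subset_comm.1 hSO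
  refine ⟨Oᶜ, ⟨?_, hVne.mono (subset_closure.trans hVO), ?_, ?_⟩, hOS.trans subset_closure, ?_⟩
  · exact isClosed_closure.isOpen_compl.connectedComponentIn.isClosed_compl
  · exact isPreconnected_compl_connectedComponentIn hVc.closure c
  · rw [compl_compl]
    exact isPreconnected_connectedComponentIn
  · have : closure S ⊆ ⋃ y ∈ t, Metric.closedBall y ε :=
      closure_minimal (ht.trans (iUnion₂_mono fun y _ => Metric.ball_subset_closedBall))
        (htfin.isClosed_biUnion fun y _ => Metric.isClosed_closedBall)
    intro x hx
    obtain ⟨y, hy, hxy⟩ := mem_iUnion₂.1 (this hx)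
    exact ⟨y, hVO (subset_closure (htV hy)), hxy⟩

theorem IsNonseparating.exists_mem_isPreconnected_compl_singleton {A : Set X}
    (hA : IsNonseparating A) : ∃ a ∈ A, IsPreconnected ({a}ᶜ : Set X) := by
  obtain ⟨F, hF, -, hFA, hmin⟩ := hA.exists_minimal (empty_subset A)
  suffices F.Subsingleton by
    obtain ⟨a, ha⟩ := hF.nonempty
    exact ⟨a, hFA ha, by
      rw [← this.eq_singleton_of_mem ha]
      exact hF.isPreconnected_compl⟩
  by_contra hnt
  rw [not_subsingleton_iff] at hnt
  obtain ⟨y, hyF, hy⟩ : ∃ y ∈ F, F = univ ∨ y ∈ closure Fᶜ := by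
    rcases eq_or_ne F univ with h | h
    · obtain ⟨y, hy⟩ := hF.nonempty
      exact ⟨y, hy, Or.inl h⟩
    · obtain ⟨y, hy⟩ := nonempty_frontier_iff.2 ⟨hF.nonempty, h⟩
      rw [frontier_eq_closure_inter_closure, hF.isClosed.closure_eq] at hy
      exact ⟨y, hy.1, Or.inr hy.2⟩
  obtain ⟨a, haF, hay⟩ := hnt.exists_ne y
  obtain ⟨W, hW, hyW, hWc, hWa⟩ := exists_isOpen_isConnected_mem_closure_subset
    (isOpen_compl_singleton.mem_nhds (show y ∈ ({a}ᶜ : Set X) from hay.symm))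
  have haW : a ∉ W := fun h => hWa (subset_closure h) rfl
  have hG := hF.component_diff hW hWc (hy.imp_right fun h => by
    rw [inter_comm]; exact mem_closure_iff.1 h W hW hyW) ⟨haF, haW⟩
  have hsub := connectedComponentIn_subset (F \ W) a
  have := hmin _ hG (empty_subset _) (hsub.trans sdiff_subset)
  exact (hsub (this.symm.subset hyF)).2 hyW
theorem notMem_connectedComponentIn_compl_singleton
    (hlim : ∀ S : Set X, IsOpen S → IsPreconnected S → IsPreconnected Sᶜ →
      IsPreconnected (closure S)ᶜ)
    {p q y : X} (hpq : p ≠ q) (hconn : IsPreconnected ({p, q}ᶜ : Set X))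
    (hyp : y ≠ p) (hyq : y ≠ q) : q ∉ connectedComponentIn ({y}ᶜ : Set X) p := by
  intro hq
  have : ConnectedSpace X := { toNonempty := ⟨p⟩ }
  -- A continuum avoiding `y` that joins `p` to `q`.
  obtain ⟨V₀, -, hV₀c, -, hpqV₀, hV₀y⟩ :=
    (isPreconnected_connectedComponentIn (F := ({y}ᶜ : Set X)) (x := p)
      ).exists_isOpen_isPreconnected_closure_subset
      isOpen_compl_singleton.connectedComponentIn ⟨q, hq⟩ (toFinite {p, q}).isCompact
      (pair_subset (mem_connectedComponentIn hyp.symm) hq)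
  have hyV₀ : y ∉ closure V₀ := fun h => connectedComponentIn_subset _ _ (hV₀y h) rfl
  -- Small disjoint neighbourhoods of `p` and `q` avoiding `y`.
  obtain ⟨M, N, hM, hN, hpM, hqN, hMN⟩ := t2_separation hpq
  replace hM : IsOpen (M \ {y}) := hM.sdiff isClosed_singleton
  replace hN : IsOpen (N \ {y}) := hN.sdiff isClosed_singleton
  replace hpM : p ∈ M \ {y} := ⟨hpM, hyp.symm⟩
  replace hqN : q ∈ N \ {y} := ⟨hqN, hyq.symm⟩
  replace hMN : Disjoint (M \ {y}) (N \ {y}) := hMN.mono sdiff_subset sdiff_subset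
  have hyMN : y ∉ M \ {y} ∪ N \ {y} := by simp
  generalize M \ {y} = M at *
  generalize N \ {y} = N at *
  -- A connected open set containing everything outside these neighbourhoods.
  obtain ⟨V, hV, hVc, hVne, hMNV, hVpq⟩ :=
    hconn.exists_isOpen_isPreconnected_closure_subset (toFinite _).isClosed.isOpen_compl
      ⟨y, by simp [hyp, hyq]⟩ (hM.union hN).isClosed_compl.isCompact
      (compl_subset_compl.2 (pair_subset (Or.inl hpM) (Or.inr hqN)))
  have hVMN : Vᶜ ⊆ M ∪ N := compl_subset_comm.1 hMNV
  have hnhds : ∀ x ∈ ({p, q} : Set X), Vᶜ ∈ 𝓝 x := fun x hx =>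
    Filter.mem_of_superset (isClosed_closure.isOpen_compl.mem_nhds fun h => hVpq h hx)
      (compl_subset_compl.2 subset_closure)
  have hpV := hnhds p (by simp)
  have hqV := hnhds q (by simp)
  set P := connectedComponentIn Vᶜ p with hP
  set Q := connectedComponentIn Vᶜ q with hQ
  have hPnhds : P ∈ 𝓝 p := connectedComponentIn_mem_nhds hpV
  have hQnhds : Q ∈ 𝓝 q := connectedComponentIn_mem_nhds hqV
  have hPc : IsPreconnected P := isPreconnected_connectedComponentIn
  have hQc : IsPreconnected Q := isPreconnected_connectedComponentIn
  have hpP : p ∈ P := mem_of_mem_nhds hPnhds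
  have hqQ : q ∈ Q := mem_of_mem_nhds hQnhds
  have hPV : P ⊆ Vᶜ := connectedComponentIn_subset _ _
  have hQV : Q ⊆ Vᶜ := connectedComponentIn_subset _ _
  have hZ : IsClosed (P ∪ Q) :=
    (hV.isClosed_compl.connectedComponentIn' p).union (hV.isClosed_compl.connectedComponentIn' q)
  have hyZ : y ∉ P ∪ Q := fun h => hyMN (hVMN (union_subset hPV hQV h))
  have hjoin : ∀ K : Set X, IsPreconnected K → p ∈ K → q ∈ K →
      IsPreconnected (K ∪ (P ∪ Q)) := fun K hK hp hq => by
    rw [← union_assoc]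
    exact (hK.union' ⟨p, hp, hpP⟩ hPc).union' ⟨q, Or.inl hq, hqQ⟩ hQc
  obtain ⟨F, hF, hZF, -, hmin⟩ := (isNonseparating_univ (X := X)).exists_minimal
    (subset_univ (P ∪ Q))
  have hPQF : ¬ F ⊆ Vᶜ := by
    intro hFV
    rcases hF.isPreconnected.subset_or_subset hM hN hMN (hFV.trans hVMN) with h | h
    · exact disjoint_left.1 hMN (h (hZF (Or.inr hqQ))) hqN
    · exact disjoint_left.1 hMN hpM (h (hZF (Or.inl hpP)))
  by_cases hFuniv : F = univ
  · exact hyZ (hF.mem_of_minimal hmin (by rw [hFuniv]; exact subset_univ (closure V₀)) hZF hZ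
      isClosed_closure (hjoin _ hV₀c.closure (subset_closure (hpqV₀ (by simp)))
        (subset_closure (hpqV₀ (by simp)))) ⟨p, Or.inl hpP⟩ (hFuniv ▸ mem_univ y) hyV₀
      (Or.inl hFuniv))
  -- The interior of `F` is connected, so `p` and `q` are joined by a continuum in it.
  have hint : (closure Fᶜ)ᶜ = interior F := by rw [closure_compl, compl_compl]
  have hintc : IsPreconnected (interior F) := by
    rw [← hint]
    exact hlim Fᶜ hF.isClosed.isOpen_compl hF.isPreconnected_compl
      (by rw [compl_compl]; exact hF.isPreconnected)
  have hpF : p ∈ interior F :=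
    mem_interior_iff_mem_nhds.2 (Filter.mem_of_superset hPnhds (subset_union_left.trans hZF))
  have hqF : q ∈ interior F :=
    mem_interior_iff_mem_nhds.2 (Filter.mem_of_superset hQnhds (subset_union_right.trans hZF))
  obtain ⟨V₁, -, hV₁c, -, hpqV₁, hV₁F⟩ := hintc.exists_isOpen_isPreconnected_closure_subset
    isOpen_interior ⟨p, hpF⟩ (toFinite {p, q}).isCompact (pair_subset hpF hqF)
  have hfront : closure Fᶜ ⊆ Fᶜ ∪ (P ∪ Q) := by
    intro x hx
    by_cases hxF : x ∈ F
    · refine Or.inr (hF.mem_of_minimal hmin (hV₁F.trans interior_subset) hZF hZ isClosed_closure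
        (hjoin _ hV₁c.closure (subset_closure (hpqV₁ (by simp)))
        (subset_closure (hpqV₁ (by simp)))) ⟨p, Or.inl hpP⟩ hxF (fun h => ?_) (Or.inr hx))
      rw [← compl_compl (closure Fᶜ), hint] at hx
      exact hx (hV₁F h)
    · exact Or.inl hxF
  have hVsub : V ⊆ Fᶜ ∪ (closure Fᶜ)ᶜ := by
    intro x hx
    by_cases h : x ∈ closure Fᶜ
    · exact Or.inl ((hfront h).resolve_right fun h => union_subset hPV hQV h hx)
    · exact Or.inr h
  rcases hVc.subset_or_subset hF.isClosed.isOpen_compl isClosed_closure.isOpen_compl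
    (disjoint_compl_right.mono_left subset_closure) hVsub with h | h
  · exact hPQF (subset_compl_comm.1 h)
  have hFV : Fᶜ ⊆ Vᶜ := fun x hx hxV => h hxV (subset_closure hx)
  have habsorb : ∀ a : X, connectedComponentIn Vᶜ a ⊆ F →
      Disjoint (closure Fᶜ) (connectedComponentIn Vᶜ a) := by
    intro a ha
    rw [disjoint_left]
    intro r hr hra
    have hun : IsPreconnected (insert r Fᶜ) :=
      hF.isPreconnected_compl.subset_closure (subset_insert _ _)
        (insert_subset hr subset_closure)
    have : insert r Fᶜ ⊆ connectedComponentIn Vᶜ r :=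
      hun.subset_connectedComponentIn (mem_insert _ _)
        (insert_subset (connectedComponentIn_subset _ _ hra) hFV)
    rw [← connectedComponentIn_eq hra] at this
    obtain ⟨z, hz⟩ := nonempty_compl.2 hFuniv
    exact hz (ha (this (Or.inr hz)))
  have hdisj : Disjoint (closure Fᶜ) (P ∪ Q) := disjoint_union_right.2
    ⟨habsorb p (subset_union_left.trans hZF), habsorb q (subset_union_right.trans hZF)⟩
  have hclosed : IsClosed Fᶜ := isClosed_of_closure_subset fun x hx =>
    (hfront hx).resolve_right (disjoint_left.1 hdisj hx)
  rcases isClopen_iff.1 ⟨hclosed, hF.isClosed.isOpen_compl⟩ with h | h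
  · exact hFuniv (compl_empty_iff.1 h)
  · exact (h.symm.subset (mem_univ p)) (interior_subset hpF)

theorem isPreconnected_compl_singleton_of_forall_pair
    (hlim : ∀ S : Set X, IsOpen S → IsPreconnected S → IsPreconnected Sᶜ →
      IsPreconnected (closure S)ᶜ)
    (hpair : ∀ p q : X, p ≠ q → ¬ IsPreconnected ({p, q}ᶜ : Set X)) (c : X) :
    IsPreconnected ({c}ᶜ : Set X) := by
  by_contra hc
  have hclos := closure_connectedComponentIn_compl_singleton_subset c
  have hnoncut : ∀ x ≠ c, ∃ a ∈ connectedComponentIn ({c}ᶜ : Set X) x,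
      IsPreconnected ({a}ᶜ : Set X) := by
    intro x hx
    have hO : IsPreconnected (connectedComponentIn ({c}ᶜ : Set X) x) :=
      isPreconnected_connectedComponentIn
    have : IsNonseparating (closure (connectedComponentIn ({c}ᶜ : Set X) x)) :=
      ⟨isClosed_closure, ⟨x, subset_closure (mem_connectedComponentIn hx)⟩, hO.closure,
        hlim _ isOpen_compl_singleton.connectedComponentIn hO
          (isPreconnected_compl_connectedComponentIn isPreconnected_singleton x)⟩
    obtain ⟨a, ha, hac⟩ := this.exists_mem_isPreconnected_compl_singleton
    refine ⟨a, (hclos x ha).resolve_left ?_, hac⟩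
    rintro rfl
    exact hc hac
  obtain ⟨x, hx, z, hz, hxz⟩ : ∃ x ∈ ({c}ᶜ : Set X), ∃ z ∈ ({c}ᶜ : Set X),
      z ∉ connectedComponentIn ({c}ᶜ : Set X) x := by
    by_contra! h
    refine hc (isPreconnected_of_forall_pair fun x hx z hz => ?_)
    exact ⟨_, connectedComponentIn_subset _ _, mem_connectedComponentIn hx, h x hx z hz,
      isPreconnected_connectedComponentIn⟩
  obtain ⟨a, haO, ha⟩ := hnoncut x hx
  obtain ⟨b, hbO, hb⟩ := hnoncut z hz
  set O := connectedComponentIn ({c}ᶜ : Set X) x with hOdef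
  have hO : IsOpen O := isOpen_compl_singleton.connectedComponentIn
  have hcO : c ∉ O := fun h => connectedComponentIn_subset _ _ h rfl
  have hac : a ≠ c := fun h => hcO (h ▸ haO)
  have hbc : b ≠ c := connectedComponentIn_subset _ _ hbO
  have hbO' : b ∉ O := fun h => hxz (by
    rw [hOdef, connectedComponentIn_eq h, ← connectedComponentIn_eq hbO]
    exact mem_connectedComponentIn hz)
  have hbcl : b ∈ (closure O)ᶜ := fun h => (hclos x h).elim hbc hbO'
  have key : ∀ u v : Set X, IsOpen u → IsOpen v → ({a, b}ᶜ : Set X) ⊆ u ∪ v →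
      ({a, b}ᶜ : Set X) ∩ (u ∩ v) = ∅ → c ∈ u → ({a, b}ᶜ : Set X) ⊆ u := by
    intro u v hu hv hsub hdisj hcu
    have hab : IsOpen ({a, b}ᶜ : Set X) := (toFinite _).isClosed.isOpen_compl
    have hcab : c ∈ ({a, b}ᶜ : Set X) := by simp [hac.symm, hbc.symm]
    have hcv : c ∉ v := fun h => notMem_empty c (hdisj ▸ ⟨hcab, hcu, h⟩)
    set u' := u ∩ ({a, b}ᶜ : Set X)
    set v' := v ∩ ({a, b}ᶜ : Set X)
    have hu' : IsOpen u' := hu.inter hab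
    have hv' : IsOpen v' := hv.inter hab
    have hcu' : c ∈ u' := ⟨hcu, hcab⟩
    have huv : ∀ t ∈ v', t ∉ u' := fun t ht htu =>
      notMem_empty t (hdisj ▸ ⟨ht.2, htu.1, ht.1⟩)
    have hcover : ∀ t, t = a ∨ t = b ∨ t ∈ u' ∨ t ∈ v' := by
      intro t
      by_cases ht : t ∈ ({a, b}ᶜ : Set X)
      · rcases hsub ht with h | h
        · exact Or.inr (Or.inr (Or.inl ⟨h, ht⟩))
        · exact Or.inr (Or.inr (Or.inr ⟨h, ht⟩))
      · rw [notMem_compl_iff] at ht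
        rcases ht with h | h
        · exact Or.inl h
        · exact Or.inr (Or.inl h)
    have hv'O : ∀ t ∈ v', t ∉ O → t ∈ (closure O)ᶜ := fun t ht htO h =>
      (hclos x h).elim (fun h => hcv (h ▸ ht.1)) htO
    have h1 : ({a}ᶜ : Set X) ⊆ u' ∪ (closure O)ᶜ := by
      refine ha.subset_right_of_subset_union (hv'.inter hO)
        (hu'.union isClosed_closure.isOpen_compl) ?_ ?_ ⟨c, hac.symm, Or.inl hcu'⟩
      · rw [disjoint_left]
        rintro t ⟨ht, htO⟩ (h | h)
        · exact huv t ht h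
        · exact h (subset_closure htO)
      · intro t ht
        rcases hcover t with h | h | h | h
        · exact absurd h ht
        · exact Or.inr (Or.inr (h ▸ hbcl))
        · exact Or.inr (Or.inl h)
        · by_cases htO : t ∈ O
          · exact Or.inl ⟨h, htO⟩
          · exact Or.inr (Or.inr (hv'O t h htO))
    have h2 : ({b}ᶜ : Set X) ⊆ u' ∪ O := by
      refine hb.subset_right_of_subset_union (hv'.inter (isClosed_closure (s := O)).isOpen_compl)
        (hu'.union hO) ?_ ?_ ⟨c, hbc.symm, Or.inl hcu'⟩
      · rw [disjoint_left]
        rintro t ⟨ht, htO⟩ (h | h)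
        · exact huv t ht h
        · exact htO (subset_closure h)
      · intro t ht
        rcases hcover t with h | h | h | h
        · exact Or.inr (Or.inr (h ▸ haO))
        · exact absurd h ht
        · exact Or.inr (Or.inl h)
        · by_cases htO : t ∈ O
          · exact Or.inr (Or.inr htO)
          · exact Or.inl ⟨h, hv'O t h htO⟩
    intro t ht
    have hta : t ∈ ({a}ᶜ : Set X) := fun h => ht (Or.inl h)
    have htb : t ∈ ({b}ᶜ : Set X) := fun h => ht (Or.inr h)
    rcases h1 hta with h | h
    · exact h.1
    rcases h2 htb with h' | h'
    · exact h'.1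
    · exact absurd (subset_closure h') h
  refine hpair a b (fun h => hbO' (h ▸ haO)) (isPreconnected_iff_subset_of_disjoint.2 ?_)
  intro u v hu hv hsub hdisj
  rcases hsub (show c ∈ ({a, b}ᶜ : Set X) by simp [hac.symm, hbc.symm]) with h | h
  · exact Or.inl (key u v hu hv hsub hdisj h)
  · exact Or.inr (key v u hv hu (by rwa [union_comm]) (by rwa [inter_comm v]) h)

end Continuum

section Cut

variable {X : Type*}

theorem IsPreconnected.sdiff_of_subset_insert_union [TopologicalSpace X] {S M N : Set X} {y : X}
    (hS : IsPreconnected S) (hM : IsOpen M) (hN : IsOpen N) (hMN : Disjoint M N) (hyS : y ∈ S)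
    (hyN : y ∉ N) (hsub : S ⊆ insert y (M ∪ N)) : IsPreconnected (S \ N) := by
  have key : ∀ u v : Set X, IsOpen u → IsOpen v → S \ N ⊆ u ∪ v → S \ N ∩ (u ∩ v) = ∅ → y ∈ u →
      S \ N ⊆ u := by
    intro u v hu hv huv hdisj hyu
    have hdisj' : ∀ t ∈ S \ N, t ∈ u → t ∉ v := fun t ht h h' =>
      notMem_empty t (hdisj ▸ ⟨ht, h, h'⟩)
    have := isPreconnected_iff_subset_of_disjoint.1 hS (v ∩ M) (u ∪ N) (hv.inter hM) (hu.union hN)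
      (by
        intro t ht
        by_cases htN : t ∈ N
        · exact Or.inr (Or.inr htN)
        rcases huv ⟨ht, htN⟩ with h | h
        · exact Or.inr (Or.inl h)
        rcases hsub ht with rfl | h' | h'
        · exact Or.inr (Or.inl hyu)
        · exact Or.inl ⟨h, h'⟩
        · exact absurd h' htN)
      (by
        refine eq_empty_of_forall_notMem ?_
        rintro t ⟨ht, ⟨htv, htM⟩, h⟩
        have htN : t ∉ N := disjoint_left.1 hMN htM
        exact hdisj' t ⟨ht, htN⟩ (h.resolve_right htN) htv)
    rcases this with h | h
    · exact absurd (h hyS).1 (hdisj' y ⟨hyS, hyN⟩ hyu)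
    · exact fun t ht => (h ht.1).resolve_right ht.2
  refine isPreconnected_iff_subset_of_disjoint.2 fun u v hu hv huv hdisj => ?_
  rcases huv ⟨hyS, hyN⟩ with h | h
  · exact Or.inl (key u v hu hv huv hdisj h)
  · exact Or.inr (key v u hv hu (by rwa [union_comm]) (by rwa [inter_comm v]) h)

theorem isPreconnected_compl_of_cut [TopologicalSpace X] {M N : Set X} {p q : X} (hpq : p ≠ q)
    (hM : IsOpen M) (hN : IsOpen N) (hMN : Disjoint M N) (hcover : M ∪ N = {p, q}ᶜ)
    (hMne : M.Nonempty) (hp : IsPreconnected ({p}ᶜ : Set X))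
    (hq : IsPreconnected ({q}ᶜ : Set X)) : IsPreconnected Nᶜ := by
  have hpN : p ∉ N := fun h => hcover.subset (Or.inr h) (by simp)
  have hqN : q ∉ N := fun h => hcover.subset (Or.inr h) (by simp)
  have h1 : IsPreconnected ({p}ᶜ \ N) := hp.sdiff_of_subset_insert_union hM hN hMN
    (y := q) hpq.symm hqN fun t ht => by
      rw [hcover]; by_cases h : t = q <;> simp_all
  have h2 : IsPreconnected ({q}ᶜ \ N) := hq.sdiff_of_subset_insert_union hM hN hMN
    (y := p) hpq hpN fun t ht => by
      rw [hcover]; by_cases h : t = p <;> simp_all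
  obtain ⟨m, hm⟩ := hMne
  have hm' : m ∈ ({p, q}ᶜ : Set X) := hcover.subset (Or.inl hm)
  have hmN := disjoint_left.1 hMN hm
  have : Nᶜ = {p}ᶜ \ N ∪ {q}ᶜ \ N := by
    ext t
    by_cases h : t = p <;> simp_all
  rw [this]
  exact h1.union m ⟨fun h => hm' (Or.inl h), hmN⟩ ⟨fun h => hm' (Or.inr h), hmN⟩ h2

theorem locallyConnectedSpace_compl_of_cut [TopologicalSpace X] [T1Space X]
    [LocallyConnectedSpace X] {M N Z : Set X} (hM : IsOpen M) (hN : IsOpen N) (hMN : Disjoint M N)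
    (hZ : Z.Finite) (hcover : M ∪ N = Zᶜ) : LocallyConnectedSpace ↥(Nᶜ) := by
  rw [locallyConnectedSpace_iff_connected_subsets]
  rintro ⟨x, hx⟩ U hU
  obtain ⟨U', hU', hsub⟩ := (mem_nhds_subtype _ _ _).1 hU
  have hZx : (Z \ {x})ᶜ ∈ 𝓝 x := (hZ.sdiff).isClosed.isOpen_compl.mem_nhds (by simp)
  obtain ⟨W, hW, hWo, hxW, hWc⟩ := locallyConnectedSpace_iff_subsets_isOpen_isConnected.1
    ‹_› x _ (Filter.inter_mem hU' hZx)
  refine ⟨Subtype.val ⁻¹' W, continuous_subtype_val.continuousAt.preimage_mem_nhds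
    (hWo.mem_nhds hxW), ?_, (preimage_mono (hW.trans inter_subset_left)).trans hsub⟩
  rw [← Topology.IsInducing.subtypeVal.isPreconnected_image, Subtype.image_preimage_coe,
    inter_comm, ← sdiff_eq]
  refine hWc.isPreconnected.sdiff_of_subset_insert_union hM hN hMN hxW hx fun t ht => ?_
  by_cases h : t = x
  · exact Or.inl h
  · refine Or.inr (hcover.symm.subset fun htZ => (hW ht).2 ⟨htZ, h⟩)

theorem subset_of_isPreconnected_of_cut [TopologicalSpace X] {M N : Set X} {p q : X}
    (hcut : ∀ a : X, IsPreconnected ({a}ᶜ : Set X))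
    (hpair : ∀ x y : X, x ≠ y → ¬ IsPreconnected ({x, y}ᶜ : Set X))
    (hM : IsOpen M) (hN : IsOpen N) (hMN : Disjoint M N) (hcover : M ∪ N = {p, q}ᶜ)
    (hNne : N.Nonempty) {C : Set X} (hC : IsPreconnected C) (hCN : C ⊆ Nᶜ) (hpC : p ∈ C)
    (hqC : q ∈ C) : M ⊆ C := by
  intro x hxM
  by_contra hxC
  obtain ⟨y, hyN⟩ := hNne
  have hCxy : C ⊆ {x, y}ᶜ := by
    rintro t ht (rfl | rfl)
    · exact hxC ht
    · exact hCN ht hyN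
  have side : ∀ (G H A B : Set X) (a : X), IsOpen G → IsOpen H → IsOpen A → IsOpen B →
      A ∪ B = {p, q}ᶜ → Disjoint A B → ({a}ᶜ : Set X) ∩ A ⊆ G ∪ H →
      ({a}ᶜ : Set X) ∩ A ∩ (G ∩ H) = ∅ → p ∈ G → q ∈ G → a ≠ p → {a}ᶜ ⊆ G ∪ B := by
    intro G H A B a hG hH hA hB hAB hdisj hsub hGH hp hq hap
    have := isPreconnected_iff_subset_of_disjoint.1 (hcut a) (H ∩ A) (G ∪ B) (hH.inter hA)
      (hG.union hB) (by
        intro t ht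
        by_cases htp : t ∈ ({p, q} : Set X)
        · rcases htp with rfl | rfl
          · exact Or.inr (Or.inl hp)
          · exact Or.inr (Or.inl hq)
        rcases hAB.symm.subset htp with h | h
        · exact (hsub ⟨ht, h⟩).elim (fun h' => Or.inr (Or.inl h')) fun h' => Or.inl ⟨h', h⟩
        · exact Or.inr (Or.inr h))
      (by
        refine eq_empty_of_forall_notMem ?_
        rintro t ⟨ht, ⟨htH, htA⟩, h⟩
        exact notMem_empty t (hGH ▸ ⟨⟨ht, htA⟩, h.resolve_right (disjoint_left.1 hdisj htA), htH⟩))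
    refine this.resolve_left fun h => ?_
    exact hAB.subset (Or.inl (h (show p ∈ ({a}ᶜ : Set X) from hap.symm)).2) (by simp)
  have key : ∀ G H : Set X, IsOpen G → IsOpen H → ({x, y}ᶜ : Set X) ⊆ G ∪ H →
      ({x, y}ᶜ : Set X) ∩ (G ∩ H) = ∅ → C ⊆ G → ({x, y}ᶜ : Set X) ⊆ G := by
    intro G H hG hH hsub hdisj hCG
    have hM' : ({x}ᶜ : Set X) ∩ M ⊆ {x, y}ᶜ := by
      rintro t ⟨ht, htM⟩ (h | rfl)
      · exact ht h
      · exact disjoint_left.1 hMN htM hyN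
    have hN' : ({y}ᶜ : Set X) ∩ N ⊆ {x, y}ᶜ := by
      rintro t ⟨ht, htN⟩ (rfl | h)
      · exact disjoint_left.1 hMN hxM htN
      · exact ht h
    have h1 := side G H M N x hG hH hM hN hcover hMN (hM'.trans hsub)
      (subset_empty_iff.1 (hdisj ▸ inter_subset_inter_left _ hM')) (hCG hpC) (hCG hqC)
      fun h => hxC (h ▸ hpC)
    have h2 := side G H N M y hG hH hN hM (by rwa [union_comm]) hMN.symm (hN'.trans hsub)
      (subset_empty_iff.1 (hdisj ▸ inter_subset_inter_left _ hN')) (hCG hpC) (hCG hqC)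
      fun h => hCN hpC (h ▸ hyN)
    intro t ht
    rcases h1 (show t ∈ ({x}ᶜ : Set X) from fun h => ht (Or.inl h)) with h | h
    · exact h
    rcases h2 (show t ∈ ({y}ᶜ : Set X) from fun h => ht (Or.inr h)) with h' | h'
    · exact h'
    · exact absurd h (disjoint_left.1 hMN h')
  refine hpair x y (fun h => disjoint_left.1 hMN hxM (h ▸ hyN))
    (isPreconnected_iff_subset_of_disjoint.2 fun G H hG hH hsub hdisj => ?_)
  rcases isPreconnected_iff_subset_of_disjoint.1 hC G H hG hH (hCxy.trans hsub)
    (subset_empty_iff.1 (hdisj ▸ inter_subset_inter_left _ hCxy)) with h | h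
  · exact Or.inl (key G H hG hH hsub hdisj h)
  · exact Or.inr (key H G hH hG (by rwa [union_comm]) (by rwa [inter_comm H]) h)

/-- If no point but every pair of points separates a locally connected continuum, then each side of
a pair of points is an arc with these end points. -/
theorem exists_homeomorph_compl_of_cut [MetricSpace X] [CompactSpace X] [LocallyConnectedSpace X]
    (hcut : ∀ a : X, IsPreconnected ({a}ᶜ : Set X))
    (hpair : ∀ x y : X, x ≠ y → ¬ IsPreconnected ({x, y}ᶜ : Set X))
    {M N : Set X} {p q : X} (hpq : p ≠ q)
    (hM : IsOpen M) (hN : IsOpen N) (hMN : Disjoint M N) (hcover : M ∪ N = {p, q}ᶜ)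
    (hMne : M.Nonempty) (hNne : N.Nonempty) :
    ∃ f : ↥(Nᶜ) ≃ₜ unitInterval, (∀ h, f ⟨p, h⟩ = 0) ∧ ∀ h, f ⟨q, h⟩ = 1 := by
  have hpN : p ∈ Nᶜ := fun h => hcover.subset (Or.inr h) (by simp)
  have hqN : q ∈ Nᶜ := fun h => hcover.subset (Or.inr h) (by simp)
  have : ConnectedSpace ↥(Nᶜ) := isConnected_iff_connectedSpace.1
    ⟨⟨p, hpN⟩, isPreconnected_compl_of_cut hpq hM hN hMN hcover hMne (hcut p) (hcut q)⟩
  have : LocallyConnectedSpace ↥(Nᶜ) :=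
    locallyConnectedSpace_compl_of_cut hM hN hMN (toFinite {p, q}) hcover
  have : CompactSpace ↥(Nᶜ) := isCompact_iff_compactSpace.1 hN.isClosed_compl.isCompact
  obtain ⟨f, hfp, hfq⟩ := exists_homeomorph_unitInterval (X := ↥(Nᶜ)) (p := ⟨p, hpN⟩)
    (q := ⟨q, hqN⟩) (fun h => hpq (congrArg Subtype.val h)) (by
      rintro ⟨x, hx⟩ hq
      have hne : connectedComponentIn ({⟨x, hx⟩}ᶜ : Set ↥(Nᶜ)) ⟨p, hpN⟩ ⊆ {⟨x, hx⟩}ᶜ :=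
        connectedComponentIn_subset _ _
      have hp : (⟨p, hpN⟩ : ↥(Nᶜ)) ∈ connectedComponentIn ({⟨x, hx⟩}ᶜ : Set ↥(Nᶜ)) ⟨p, hpN⟩ :=
        mem_connectedComponentIn (connectedComponentIn_nonempty_iff.1 ⟨_, hq⟩)
      have hxM : x ∈ M := by
        refine (hcover.symm.subset ?_).resolve_right hx
        rintro (rfl | rfl)
        · exact hne hp rfl
        · exact hne hq rfl
      obtain ⟨z, hz, rfl⟩ := subset_of_isPreconnected_of_cut hcut hpair hM hN hMN hcover hNne
        (isPreconnected_connectedComponentIn.image _ continuous_subtype_val.continuousOn)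
        (image_subset_iff.2 fun z _ => z.2) ⟨_, hp, rfl⟩ ⟨_, hq, rfl⟩ hxM
      exact hne hz rfl)
  exact ⟨f, fun _ => hfp, fun _ => hfq⟩

end Cut

section Gluing

open Real in
/-- Two arcs that share exactly their end points form a circle. -/
theorem nonempty_homeomorph_circle_of_arcs {X : Type*} [TopologicalSpace X] [CompactSpace X]
    {A B : Set X} (hA : IsClosed A) (hB : IsClosed B) (hAB : A ∪ B = univ) {p q : X}
    (hinter : A ∩ B = {p, q}) (f : A ≃ₜ unitInterval) (g : B ≃ₜ unitInterval)
    (hfp : ∀ h, f ⟨p, h⟩ = 0) (hfq : ∀ h, f ⟨q, h⟩ = 1) (hgp : ∀ h, g ⟨p, h⟩ = 0)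
    (hgq : ∀ h, g ⟨q, h⟩ = 1) : Nonempty (X ≃ₜ Circle) := by
  classical
  have hcover : ∀ x, x ∉ A → x ∈ B := fun x hx => (hAB.symm.subset (mem_univ x)).resolve_left hx
  have hp : p ∈ A ∩ B := by simp [hinter]
  have hq : q ∈ A ∩ B := by simp [hinter]
  let φ : X → ℝ := fun x => if h : x ∈ A then π * f ⟨x, h⟩ else -(π * g ⟨x, hcover x h⟩)
  have hφA : ∀ x : A, φ x = π * f x := fun x => dif_pos x.2
  have hφB : ∀ x : B, Circle.exp (φ x) = Circle.exp (-(π * g x)) := by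
    rintro ⟨x, hxB⟩
    by_cases hxA : x ∈ A
    · rw [hφA ⟨x, hxA⟩]
      rcases hinter.subset ⟨hxA, hxB⟩ with rfl | rfl
      · simp [hfp, hgp]
      · have := Circle.exp_sub_two_pi π
        rw [hfq, hgq, Icc.coe_one, mul_one, ← this]
        congr 1
        ring
    · rw [show φ x = -(π * g ⟨x, hxB⟩) from dif_neg hxA]
  have hpos : ∀ t : unitInterval, 0 ≤ π * t := fun t => mul_nonneg pi_pos.le t.2.1
  have hle : ∀ t : unitInterval, π * t ≤ π := fun t => mul_le_of_le_one_right pi_pos.le t.2.2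
  have hneg : ∀ x, ∀ h : x ∉ A, φ x = -(π * g ⟨x, hcover x h⟩) ∧ φ x ∈ Ioo (-π) 0 := by
    intro x h
    have hne : ∀ y : B, (y : X) ∈ A → g ⟨x, hcover x h⟩ ≠ g y := fun y hy hxy =>
      h (by rw [← g.injective hxy] at hy; exact hy)
    have h0 := hne ⟨p, hp.2⟩ hp.1
    have h1 := hne ⟨q, hq.2⟩ hq.1
    rw [hgp] at h0
    rw [hgq] at h1
    have hφ : φ x = -(π * g ⟨x, hcover x h⟩) := dif_neg h
    refine ⟨hφ, ?_⟩
    rw [hφ]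
    have := mul_lt_of_lt_one_right pi_pos (unitInterval.lt_one_iff_ne_one.2 h1)
    have := mul_pos pi_pos (unitInterval.pos_iff_ne_zero.2 h0)
    constructor <;> linarith
  have hφmem : ∀ x, φ x ∈ Ioc (-π) π := by
    intro x
    by_cases h : x ∈ A
    · rw [hφA ⟨x, h⟩]
      exact ⟨(neg_neg_of_pos pi_pos).trans_le (hpos _), hle _⟩
    · obtain ⟨-, h1, h2⟩ := hneg x h
      exact ⟨h1, h2.le.trans pi_pos.le⟩
  have hφinj : Function.Injective φ := by
    intro x y hxy
    by_cases hx : x ∈ A <;> by_cases hy : y ∈ A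
    · rw [hφA ⟨x, hx⟩, hφA ⟨y, hy⟩] at hxy
      exact congrArg Subtype.val (f.injective (Subtype.ext (mul_left_cancel₀ pi_pos.ne' hxy)))
    · have h1 := (hneg y hy).2.2
      rw [← hxy, hφA ⟨x, hx⟩] at h1
      exact absurd h1 (hpos _).not_gt
    · have h1 := (hneg x hx).2.2
      rw [hxy, hφA ⟨y, hy⟩] at h1
      exact absurd h1 (hpos _).not_gt
    · rw [(hneg x hx).1, (hneg y hy).1] at hxy
      exact congrArg Subtype.val
        (g.injective (Subtype.ext (mul_left_cancel₀ pi_pos.ne' (neg_injective hxy))))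
  have hcont : Continuous fun x => Circle.exp (φ x) := by
    rw [← continuousOn_univ, ← hAB]
    refine ContinuousOn.union_of_isClosed ?_ ?_ hA hB
    · rw [continuousOn_iff_continuous_domRestrict]
      refine Continuous.congr (f := fun x : A => Circle.exp (π * f x)) (by fun_prop) fun x => ?_
      rw [← hφA]
      rfl
    · rw [continuousOn_iff_continuous_domRestrict]
      exact Continuous.congr (f := fun x : B => Circle.exp (-(π * g x))) (by fun_prop)
        fun x => (hφB x).symm
  have hinj : Function.Injective fun x => Circle.exp (φ x) := fun x y hxy =>
    hφinj (Circle.exp_injOn_Ioc (by linarith) (hφmem x) (hφmem y) hxy)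
  have hsurj : Function.Surjective fun x => Circle.exp (φ x) := by
    intro z
    obtain ⟨θ, ⟨hθ, hθ'⟩, rfl⟩ := Circle.surjOn_exp_neg_pi_pi (mem_univ z)
    rcases le_total 0 θ with h | h
    · refine ⟨f.symm ⟨θ / π, div_nonneg h pi_pos.le, div_le_one_of_le₀ hθ' pi_pos.le⟩, ?_⟩
      simp only [hφA, Homeomorph.apply_symm_apply]
      rw [mul_div_cancel₀ _ pi_pos.ne']
    · refine ⟨g.symm ⟨-θ / π, div_nonneg (neg_nonneg.2 h) pi_pos.le,
        div_le_one_of_le₀ (neg_le.1 hθ.le) pi_pos.le⟩, ?_⟩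
      simp only [hφB, Homeomorph.apply_symm_apply]
      rw [mul_div_cancel₀ _ pi_pos.ne', neg_neg]
  exact ⟨hcont.homeoOfEquivCompactToT2 (f := Equiv.ofBijective _ ⟨hinj, hsurj⟩)⟩

theorem nonempty_homeomorph_circle_of_forall_pair {X : Type*} [MetricSpace X] [CompactSpace X]
    [LocallyConnectedSpace X] [Nontrivial X]
    (hcut : ∀ a : X, IsPreconnected ({a}ᶜ : Set X))
    (hpair : ∀ x y : X, x ≠ y → ¬ IsPreconnected ({x, y}ᶜ : Set X)) :
    Nonempty (X ≃ₜ Circle) := by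
  obtain ⟨p, q, hpq⟩ := exists_pair_ne X
  have hopen : IsOpen ({p, q}ᶜ : Set X) := (toFinite _).isClosed.isOpen_compl
  obtain ⟨M, N, hM, hN, hMN, hcover, hMne, hNne⟩ : ∃ M N : Set X, IsOpen M ∧ IsOpen N ∧
      Disjoint M N ∧ M ∪ N = {p, q}ᶜ ∧ M.Nonempty ∧ N.Nonempty := by
    by_contra! h
    refine hpair p q hpq (isPreconnected_iff_subset_of_disjoint.2 fun u v hu hv huv hdisj => ?_)
    rcases ({p, q}ᶜ ∩ u).eq_empty_or_nonempty with hu' | hu'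
    · exact Or.inr fun t ht => (huv ht).resolve_left fun h => notMem_empty t (hu' ▸ ⟨ht, h⟩)
    · have := h _ _ (hopen.inter hu) (hopen.inter hv)
        (by rw [disjoint_iff_inter_eq_empty, ← inter_inter_distrib_left, hdisj])
        (by rw [← inter_union_distrib_left, inter_eq_left.2 huv]) hu'
      exact Or.inl fun t ht => (huv ht).resolve_right fun h => notMem_empty t (this ▸ ⟨ht, h⟩)
  have hcover' : N ∪ M = {p, q}ᶜ := by rwa [union_comm]
  obtain ⟨f, hfp, hfq⟩ := exists_homeomorph_compl_of_cut hcut hpair hpq hM hN hMN hcover hMne hNne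
  obtain ⟨g, hgp, hgq⟩ := exists_homeomorph_compl_of_cut hcut hpair hpq hN hM hMN.symm hcover'
    hNne hMne
  exact nonempty_homeomorph_circle_of_arcs hN.isClosed_compl hM.isClosed_compl
    (by rw [← compl_inter, hMN.symm.inter_eq, compl_empty])
    (by rw [← compl_union, hcover', compl_compl]) f g hfp hfq hgp hgq

end Gluing

/-- If X is a locally connected continuum such that NC*(X) is closed in C(X),
then X is homeomorphic to [0,1] or to the unit circle. -/
theorem stmt0 {X : Type*} [MetricSpace X] [CompactSpace X] [ConnectedSpace X] [Nontrivial X]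
    [LocallyConnectedSpace X]
    (h : IsClosed {A : {A : NonemptyCompacts X // IsConnected (A : Set X)} |
        IsPreconnected ((A.1 : Set X)ᶜ)}) :
    Nonempty (X ≃ₜ unitInterval) ∨ Nonempty (X ≃ₜ Circle) := by
  have hlim := isPreconnected_compl_closure_of_isClosed h
  by_cases hpair : ∀ p q : X, p ≠ q → ¬ IsPreconnected ({p, q}ᶜ : Set X)
  · exact Or.inr (nonempty_homeomorph_circle_of_forall_pair
      (isPreconnected_compl_singleton_of_forall_pair hlim hpair) hpair)
  push Not at hpair
  obtain ⟨p, q, hpq, hconn⟩ := hpair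
  obtain ⟨f, -, -⟩ := exists_homeomorph_unitInterval hpq fun x hx => by
    refine notMem_connectedComponentIn_compl_singleton hlim hpq hconn ?_ ?_ hx
    · rintro rfl
      exact connectedComponentIn_nonempty_iff.1 ⟨_, hx⟩ rfl
    · rintro rfl
      exact connectedComponentIn_subset _ _ hx rfl
  exact Or.inl ⟨f⟩
end

section
/- Let X be a locally connected continuum. Then NC*(X) = C(X) if and only if X is homeomorphic to the unit circle. -/
open TopologicalSpace Set

/-- The running maximum of a continuous function on a compact space with a closed linear order
is continuous. -/
lemma exists_continuous_running_max {Y : Type*} [TopologicalSpace Y] [CompactSpace Y]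
    [LinearOrder Y] [ClosedIicTopology Y] [ClosedIciTopology Y] {φ : Y → ℝ}
    (hφ : Continuous φ) :
    ∃ g : Y → ℝ, Continuous g ∧ ∀ p, IsGreatest (φ '' Iic p) (g p) := by
  have h : ∀ p, ∃ t, IsGreatest (φ '' Iic p) t := fun p =>
    (isClosed_Iic.isCompact.image hφ).exists_isGreatest (nonempty_Iic.image φ)
  choose g hg using h
  refine ⟨g, OrderTopology.continuous_iff.2 fun t => ⟨?_, ?_⟩, hg⟩
  · have : g ⁻¹' Ioi t = φ ⁻¹' Ioi t ∪ ⋃ q ∈ φ ⁻¹' Ioi t, Ioi q := by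
      ext p
      simp only [mem_preimage, mem_Ioi, mem_union, mem_iUnion, exists_prop]
      constructor
      · intro hp
        obtain ⟨q, hq, hqp⟩ := (hg p).1
        rcases (mem_Iic.1 hq).eq_or_lt with rfl | hlt
        · exact Or.inl (hqp ▸ hp)
        · exact Or.inr ⟨q, hqp ▸ hp, hlt⟩
      · rintro (hp | ⟨q, hq, hlt⟩)
        · exact hp.trans_le ((hg p).2 ⟨p, le_rfl, rfl⟩)
        · exact hq.trans_le ((hg p).2 ⟨q, hlt.le, rfl⟩)
    rw [this]
    exact (isOpen_Ioi.preimage hφ).union (isOpen_biUnion fun q _ => isOpen_Ioi)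
  · rw [← isClosed_compl_iff]
    have hc : IsCompact (φ ⁻¹' Ici t) := (isClosed_Ici.preimage hφ).isCompact
    rcases (φ ⁻¹' Ici t).eq_empty_or_nonempty with he | hne
    · convert isClosed_empty
      ext p
      simp only [mem_compl_iff, mem_preimage, mem_Iio, not_lt, mem_empty_iff_false, iff_false]
      intro hp
      obtain ⟨q, -, hqp⟩ := (hg p).1
      exact (he ▸ (show q ∈ φ ⁻¹' Ici t from hp.trans hqp.ge) : q ∈ (∅ : Set Y))
    · obtain ⟨m, hm⟩ := hc.exists_isLeast hne
      convert isClosed_Ici (a := m)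
      ext p
      simp only [mem_compl_iff, mem_preimage, mem_Iio, not_lt, mem_Ici]
      constructor
      · intro hp
        obtain ⟨q, hq, hqp⟩ := (hg p).1
        exact (hm.2 (show q ∈ φ ⁻¹' Ici t from hp.trans hqp.ge)).trans hq
      · exact fun hp => le_trans hm.1 ((hg p).2 ⟨m, hp, rfl⟩)

/-- A compact metric space with a closed linear order admits a continuous strictly monotone
real function. -/
lemma exists_continuous_strictMono {Y : Type*} [MetricSpace Y] [CompactSpace Y] [Nonempty Y]
    [LinearOrder Y] [ClosedIicTopology Y] [ClosedIciTopology Y] :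
    ∃ f : Y → ℝ, Continuous f ∧ StrictMono f := by
  let φ : ℕ × ℕ → Y → ℝ := fun n z => max 0 (1 / ((n.1 : ℝ) + 1) - dist z (denseSeq Y n.2))
  have hφ : ∀ n, Continuous (φ n) := fun n => by fun_prop
  have hφ0 : ∀ n z, 0 ≤ φ n z := fun n z => le_max_left _ _
  have hφ1 : ∀ n z, φ n z ≤ 1 := fun n z => by
    refine max_le zero_le_one ?_
    have : 1 / ((n.1 : ℝ) + 1) ≤ 1 := by
      rw [div_le_one (by positivity)]
      linarith [n.1.cast_nonneg (α := ℝ)]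
    linarith [dist_nonneg (x := z) (y := denseSeq Y n.2)]
  choose g hgc hg using fun n => exists_continuous_running_max (hφ n)
  have hg0 : ∀ n p, 0 ≤ g n p := fun n p => (hφ0 n p).trans ((hg n p).2 ⟨p, le_rfl, rfl⟩)
  have hg1 : ∀ n p, g n p ≤ 1 := fun n p => by
    obtain ⟨q, -, hq⟩ := (hg n p).1
    exact hq ▸ hφ1 n q
  have hmono : ∀ n, Monotone (g n) := fun n p q hpq => by
    obtain ⟨r, hr, hrp⟩ := (hg n p).1
    exact hrp ▸ (hg n q).2 ⟨r, le_trans hr hpq, rfl⟩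
  let u : ℕ × ℕ → ℝ := fun n => (1 / 2) ^ n.1 * (1 / 2) ^ n.2
  have hu0 : ∀ n, 0 < u n := fun n => by positivity
  have hu : Summable u := summable_geometric_two.mul_of_nonneg summable_geometric_two
    (fun _ => by positivity) (fun _ => by positivity)
  have hle : ∀ n p, ‖u n * g n p‖ ≤ u n := fun n p => by
    rw [Real.norm_of_nonneg (mul_nonneg (hu0 n).le (hg0 n p))]
    exact mul_le_of_le_one_right (hu0 n).le (hg1 n p)
  have hs : ∀ p, Summable fun n => u n * g n p := fun p =>
    hu.of_norm_bounded fun n => hle n p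
  refine ⟨fun p => ∑' n, u n * g n p,
    continuous_tsum (fun n => continuous_const.mul (hgc n)) hu hle, fun x y hxy => ?_⟩
  obtain ⟨ε, hε, hball⟩ := Metric.isOpen_iff.1 (isOpen_Ioi (a := x)) y hxy
  obtain ⟨k, hk⟩ := exists_nat_one_div_lt (half_pos hε)
  have hkpos : (0 : ℝ) < 1 / ((k : ℝ) + 1) := by positivity
  obtain ⟨m, hm⟩ := (denseRange_denseSeq Y).exists_dist_lt y hkpos
  refine (hs x).tsum_lt_tsum (i := (k, m))
    (fun n => mul_le_mul_of_nonneg_left (hmono n hxy.le) (hu0 n).le) ?_ (hs y)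
  refine mul_lt_mul_of_pos_left ?_ (hu0 _)
  obtain ⟨z, hz, hzx⟩ := (hg (k, m) x).1
  rw [← hzx]
  have hz0 : φ (k, m) z = 0 := by
    refine max_eq_left ?_
    by_contra! hcon
    have hzy : z ∈ Metric.ball y ε := by
      rw [Metric.mem_ball]
      have := dist_triangle_right z y (denseSeq Y m)
      simp only at hcon
      linarith
    exact absurd (hball hzy) (not_lt.2 hz)
  rw [hz0]
  refine lt_of_lt_of_le ?_ ((hg (k, m) y).2 ⟨y, le_rfl, rfl⟩)
  exact lt_max_of_lt_right (sub_pos.2 hm)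

/-- A compact connected metric space in which every point separates `a` from `b` is an arc
from `a` to `b`. -/
lemma exists_arc_parametrization {Y : Type*} [MetricSpace Y] [CompactSpace Y]
    [PreconnectedSpace Y] {a b : Y} (hab : a ≠ b)
    (H : ∀ q : Y, ∃ P Q : Set Y, IsClosed P ∧ IsClosed Q ∧ IsPreconnected P ∧ IsPreconnected Q ∧
      P ∪ Q = univ ∧ P ∩ Q = {q} ∧ a ∈ P ∧ b ∈ Q) :
    ∃ f : Y → ℝ, Continuous f ∧ Function.Injective f ∧ range f = Icc 0 1 ∧ f a = 0 ∧ f b = 1 := by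
  choose P Q hPc hQc hP hQ hU hI ha hb using H
  have hUm : ∀ q x, x ∈ P q ∨ x ∈ Q q := fun q x => by
    rw [← mem_union, hU]; trivial
  have hIm : ∀ {q x}, x ∈ P q → x ∈ Q q → x = q := fun {q x} h1 h2 => by
    have : x ∈ P q ∩ Q q := ⟨h1, h2⟩
    rwa [hI] at this
  have hqP : ∀ q, q ∈ P q := fun q => ((hI q).ge rfl).1
  have hqQ : ∀ q, q ∈ Q q := fun q => ((hI q).ge rfl).2
  have key : ∀ {p : Y} {S : Set Y}, IsPreconnected S → p ∉ S → S ⊆ P p ∨ S ⊆ Q p := by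
    intro p S hS hpS
    refine isPreconnected_iff_subset_of_disjoint_closed.1 hS _ _ (hPc p) (hQc p)
      (by rw [hU]; exact subset_univ _) ?_
    rw [hI]
    exact inter_singleton_eq_empty.2 hpS
  have hsub : ∀ {p q : Y}, p ∉ P q → P q ⊆ P p := by
    intro p q hpq
    rcases key (hP q) hpq with h | h
    · exact h
    · exact absurd (hIm (ha p) (h (ha q)) ▸ ha q) hpq
  have hsub' : ∀ {p q : Y}, q ∉ Q p → Q p ⊆ Q q := by
    intro p q hpq
    rcases key (hQ p) hpq with h | h
    · exact absurd (hIm (h (hb p)) (hb q) ▸ hb p) hpq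
    · exact h
  have antisymm : ∀ {p q : Y}, p ∈ P q → q ∈ P p → p = q := by
    intro p q h1 h2
    by_contra hne
    have : q ∉ Q p := fun h => hne (hIm h2 h).symm
    exact hne (hIm h1 (hsub' this (hqQ p)))
  let _ : LinearOrder Y :=
    { le := fun x y => x ∈ P y
      le_refl := hqP
      le_trans := fun x y z hxy hyz => by
        rcases eq_or_ne y z with rfl | hne
        · exact hxy
        · exact hsub (fun h => hne (antisymm hyz h)) hxy
      le_antisymm := fun x y => antisymm
      le_total := fun x y => by
        by_cases h : x ∈ P y
        · exact Or.inl h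
        · exact Or.inr (hsub h (hqP y))
      toDecidableLE := Classical.decRel _ }
  have hle : ∀ {x y : Y}, x ≤ y ↔ x ∈ P y := Iff.rfl
  have hleQ : ∀ {x y : Y}, x ≤ y ↔ y ∈ Q x := by
    intro x y
    rw [hle]
    constructor
    · intro h
      rcases hUm x y with h' | h'
      · exact antisymm h h' ▸ hqQ x
      · exact h'
    · intro h
      by_cases h' : y ∈ P x
      · exact hIm h' h ▸ hqP y
      · exact hsub h' (hqP x)
  have : ClosedIicTopology Y := ⟨fun q => hPc q⟩
  have : ClosedIciTopology Y := ⟨fun q => by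
    convert hQc q using 1
    ext x
    exact hleQ⟩
  have : Nonempty Y := ⟨a⟩
  obtain ⟨f, hf, hmono⟩ := exists_continuous_strictMono (Y := Y)
  have hbot : ∀ x, a ≤ x := ha
  have htop : ∀ x, x ≤ b := fun x => hleQ.2 (hb x)
  have hlt : f a < f b := hmono ((hbot b).lt_of_ne hab)
  have hd : 0 < f b - f a := sub_pos.2 hlt
  have hFc : Continuous fun x => (f x - f a) / (f b - f a) := by fun_prop
  have hFa : (f a - f a) / (f b - f a) = 0 := by simp
  have hFb : (f b - f a) / (f b - f a) = 1 := div_self hd.ne'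
  refine ⟨fun x => (f x - f a) / (f b - f a), hFc, ?_, ?_, hFa, hFb⟩
  · intro x y hxy
    have := (div_left_inj' hd.ne').1 hxy
    exact hmono.injective (by linarith)
  · apply Subset.antisymm
    · rintro _ ⟨x, rfl⟩
      constructor
      · exact div_nonneg (sub_nonneg.2 (hmono.monotone (hbot x))) hd.le
      · rw [div_le_one hd]
        linarith [hmono.monotone (htop x)]
    · have := intermediate_value_univ a b hFc
      rwa [hFa, hFb] at this

/-- A compact subset of a connected open set in a locally connected compact metric space is
contained in a closed connected subset of that open set. -/
lemma exists_isClosed_isConnected_between {X : Type*} [MetricSpace X] [LocallyConnectedSpace X]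
    {U K : Set X} (hUo : IsOpen U) (hU : IsPreconnected U) (hK : IsCompact K) (hne : K.Nonempty)
    (hKU : K ⊆ U) : ∃ A, IsClosed A ∧ IsConnected A ∧ K ⊆ A ∧ A ⊆ U := by
  obtain ⟨u, hu⟩ := hne
  have loc : ∀ x ∈ U, ∃ N ∈ nhds x, IsPreconnected N ∧ closure N ⊆ U ∧ x ∈ N := by
    intro x hx
    obtain ⟨V, hV, hVc, hVU⟩ := exists_mem_nhds_isClosed_subset (hUo.mem_nhds hx)
    obtain ⟨N, ⟨hNo, hxN, hN⟩, hNV⟩ :=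
      (LocallyConnectedSpace.open_connected_basis x).mem_iff.1 hV
    exact ⟨N, hNo.mem_nhds hxN, hN.isPreconnected, (closure_minimal hNV hVc).trans hVU, hxN⟩
  have joined : ∀ x ∈ U, ∃ A, IsClosed A ∧ IsPreconnected A ∧ A ⊆ U ∧ u ∈ A ∧ x ∈ A := by
    intro x hx
    refine hU.induction₂ (fun x y => ∃ A, IsClosed A ∧ IsPreconnected A ∧ A ⊆ U ∧ x ∈ A ∧ y ∈ A)
      ?_ ?_ ?_ (hKU hu) hx
    · intro x hx
      obtain ⟨N, hN, hNc, hNU, hxN⟩ := loc x hx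
      filter_upwards [mem_nhdsWithin_of_mem_nhds hN] with y hy
      exact ⟨closure N, isClosed_closure, hNc.closure, hNU, subset_closure hxN, subset_closure hy⟩
    · rintro x y z - - - ⟨A, hA, hAc, hAU, hxA, hyA⟩ ⟨B, hB, hBc, hBU, hyB, hzB⟩
      exact ⟨A ∪ B, hA.union hB, hAc.union y hyA hyB hBc, union_subset hAU hBU, Or.inl hxA,
        Or.inr hzB⟩
    · rintro x y - - ⟨A, hA, hAc, hAU, hxA, hyA⟩
      exact ⟨A, hA, hAc, hAU, hyA, hxA⟩
  have : ∃ A, IsClosed A ∧ IsPreconnected A ∧ A ⊆ U ∧ u ∈ A ∧ K ⊆ A := by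
    refine hK.induction_on (p := fun S => ∃ A, IsClosed A ∧ IsPreconnected A ∧ A ⊆ U ∧ u ∈ A ∧
      S ⊆ A) ?_ ?_ ?_ ?_
    · exact ⟨{u}, isClosed_singleton, isPreconnected_singleton,
        singleton_subset_iff.2 (hKU hu), rfl, empty_subset _⟩
    · rintro s t hst ⟨A, hA, hAc, hAU, huA, htA⟩
      exact ⟨A, hA, hAc, hAU, huA, hst.trans htA⟩
    · rintro s t ⟨A, hA, hAc, hAU, huA, hsA⟩ ⟨B, hB, hBc, hBU, huB, htB⟩
      exact ⟨A ∪ B, hA.union hB, hAc.union u huA huB hBc, union_subset hAU hBU, Or.inl huA,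
        union_subset_union hsA htB⟩
    · intro x hx
      obtain ⟨N, hN, hNc, hNU, hxN⟩ := loc x (hKU hx)
      obtain ⟨A, hA, hAc, hAU, huA, hxA⟩ := joined x (hKU hx)
      exact ⟨N, mem_nhdsWithin_of_mem_nhds hN, A ∪ closure N, hA.union isClosed_closure,
        hAc.union x hxA (subset_closure hxN) hNc.closure, union_subset hAU hNU, Or.inl huA,
        subset_closure.trans subset_union_right⟩
  obtain ⟨A, hA, hAc, hAU, huA, hKA⟩ := this
  exact ⟨A, hA, ⟨⟨u, huA⟩, hAc⟩, hKA, hAU⟩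

lemma closure_connectedComponentIn_subset {X : Type*} [TopologicalSpace X]
    [LocallyConnectedSpace X] {W : Set X} (hW : IsOpen W) (x : X) :
    closure (connectedComponentIn W x) ⊆ connectedComponentIn W x ∪ Wᶜ := by
  intro y hy
  by_cases hyW : y ∈ W
  · left
    obtain ⟨z, hz, hz'⟩ := mem_closure_iff.1 hy _ (hW.connectedComponentIn (x := y))
      (mem_connectedComponentIn hyW)
    rw [connectedComponentIn_eq hz', ← connectedComponentIn_eq hz]
    exact mem_connectedComponentIn hyW
  · exact Or.inr hyW

lemma left_mem_closure_connectedComponentIn {X : Type*} [MetricSpace X]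
    [LocallyConnectedSpace X]
    (H : ∀ A : Set X, IsClosed A → IsConnected A → IsPreconnected Aᶜ) {a b : X} (hab : a ≠ b)
    {x : X} (hx : x ∈ ({a, b}ᶜ : Set X)) : a ∈ closure (connectedComponentIn {a, b}ᶜ x) := by
  by_contra ha
  have hW : IsOpen ({a, b}ᶜ : Set X) := (toFinite {a, b}).isClosed.isOpen_compl
  have hcl := closure_connectedComponentIn_subset hW x
  obtain ⟨z, -, hz, hz'⟩ := H {b} isClosed_singleton isConnected_singleton _ _
    (hW.connectedComponentIn (x := x)) (isClosed_closure.isOpen_compl) (by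
      intro y hy
      by_cases hyc : y ∈ closure (connectedComponentIn {a, b}ᶜ x)
      · rcases hcl hyc with h | h
        · exact Or.inl h
        · rw [compl_compl] at h
          rcases h with rfl | h
          · exact Or.inr ha
          · exact absurd h hy
      · exact Or.inr hyc)
    ⟨x, fun h => hx (Or.inr h), mem_connectedComponentIn hx⟩ ⟨a, hab, ha⟩
  exact hz' (subset_closure hz)

section SubcontinuumComplement

variable {X : Type*} [MetricSpace X] [CompactSpace X] [ConnectedSpace X] [LocallyConnectedSpace X]

lemma not_isPreconnected_compl_pair
    (H : ∀ A : Set X, IsClosed A → IsConnected A → IsPreconnected Aᶜ) {a b : X} (hab : a ≠ b) :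
    ¬ IsPreconnected ({a, b}ᶜ : Set X) := by
  intro hU
  obtain ⟨S, T, hS, hT, haS, hbT, hST⟩ := t2_separation hab
  have hne : ((S ∪ T)ᶜ : Set X).Nonempty := by
    by_contra! hcon
    rw [compl_empty_iff] at hcon
    obtain ⟨x, -, hx⟩ := isPreconnected_univ S T hS hT hcon.ge ⟨a, trivial, haS⟩ ⟨b, trivial, hbT⟩
    exact disjoint_left.1 hST hx.1 hx.2
  obtain ⟨A, hA, hAc, hKA, hAU⟩ := exists_isClosed_isConnected_between
    (toFinite {a, b}).isClosed.isOpen_compl hU (hS.union hT).isClosed_compl.isCompact hne (by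
      apply compl_subset_compl.2
      rintro x (rfl | rfl)
      · exact Or.inl haS
      · exact Or.inr hbT)
  obtain ⟨x, -, hx⟩ := H A hA hAc S T hS hT (compl_subset_comm.1 hKA)
    ⟨a, fun h => hAU h (by simp), haS⟩ ⟨b, fun h => hAU h (by simp), hbT⟩
  exact disjoint_left.1 hST hx.1 hx.2

lemma exists_components_compl_pair
    (H : ∀ A : Set X, IsClosed A → IsConnected A → IsPreconnected Aᶜ) {a b : X} (hab : a ≠ b) :
    ∃ U V : Set X, IsOpen U ∧ IsOpen V ∧ IsConnected U ∧ IsConnected V ∧ Disjoint U V ∧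
      U ∪ V = {a, b}ᶜ ∧ closure U = U ∪ {a, b} ∧ closure V = V ∪ {a, b} := by
  have hW : IsOpen ({a, b}ᶜ : Set X) := (toFinite {a, b}).isClosed.isOpen_compl
  have hcl : ∀ x ∈ ({a, b}ᶜ : Set X), closure (connectedComponentIn {a, b}ᶜ x) =
      connectedComponentIn {a, b}ᶜ x ∪ {a, b} := by
    intro x hx
    apply Subset.antisymm
    · simpa using closure_connectedComponentIn_subset hW x
    · refine union_subset subset_closure ?_
      rintro y (rfl | rfl)
      · exact left_mem_closure_connectedComponentIn H hab hx
      · rw [pair_comm] at hx ⊢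
        exact left_mem_closure_connectedComponentIn H hab.symm hx
  have hex : ∃ x ∈ ({a, b}ᶜ : Set X), ∃ y ∈ ({a, b}ᶜ : Set X),
      y ∉ connectedComponentIn {a, b}ᶜ x := by
    by_contra! hcon
    refine not_isPreconnected_compl_pair H hab ?_
    exact isPreconnected_of_forall_pair fun x hx y hy => ⟨_, connectedComponentIn_subset _ _,
      mem_connectedComponentIn hx, hcon x hx y hy, isPreconnected_connectedComponentIn⟩
  obtain ⟨x, hx, y, hy, hxy⟩ := hex
  refine ⟨connectedComponentIn {a, b}ᶜ x, connectedComponentIn {a, b}ᶜ y,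
    hW.connectedComponentIn, hW.connectedComponentIn, isConnected_connectedComponentIn_iff.2 hx,
    isConnected_connectedComponentIn_iff.2 hy, ?_, ?_, hcl x hx, hcl y hy⟩
  · refine disjoint_left.2 fun z hz hz' => hxy ?_
    rw [connectedComponentIn_eq hz, ← connectedComponentIn_eq hz']
    exact mem_connectedComponentIn hy
  · apply Subset.antisymm
      (union_subset (connectedComponentIn_subset _ _) (connectedComponentIn_subset _ _))
    intro z hz
    by_cases hzx : z ∈ connectedComponentIn {a, b}ᶜ x
    · exact Or.inl hzx
    · right
      have hpre := H _ isClosed_closure (isConnected_connectedComponentIn_iff.2 hx).closure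
      rw [hcl x hx] at hpre
      exact hpre.subset_connectedComponentIn (by simp_all) (fun w hw h => hw (Or.inr h))
        (by simp_all)

/-- The component of `{a, q}ᶜ` that lies inside a given component `U` of `{a, b}ᶜ`, for
`q ∈ U`; the other component contains `b`. -/
lemma exists_component_subset
    (H : ∀ A : Set X, IsClosed A → IsConnected A → IsPreconnected Aᶜ) {a b q : X} {U V : Set X}
    (hUV : Disjoint U V) (hV : IsConnected V)
    (hunion : U ∪ V = {a, b}ᶜ) (hVb : b ∈ closure V) (hq : q ∈ U) (hab : a ≠ b) :
    ∃ D D' : Set X, IsOpen D ∧ IsOpen D' ∧ IsConnected D ∧ Disjoint D D' ∧ D ∪ D' = {a, q}ᶜ ∧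
      closure D = D ∪ {a, q} ∧ b ∈ D' ∧ D ⊆ U := by
  have hq' : q ∉ ({a, b} : Set X) := fun h => (hunion.le (Or.inl hq)) h
  have hqa : a ≠ q := fun h => hq' (Or.inl h.symm)
  have hqb : b ≠ q := fun h => hq' (Or.inr h.symm)
  have main : ∀ D D' : Set X, IsOpen D → IsOpen D' → Disjoint D D' → D ∪ D' = {a, q}ᶜ → b ∈ D' →
      D ⊆ U := by
    intro D D' hD hD' hdis hDD hb x hx
    have hVsub : V ∪ {b} ⊆ D' := by
      refine IsPreconnected.subset_left_of_subset_union hD' hD hdis.symm ?_ ⟨b, Or.inr rfl, hb⟩ ?_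
      · rw [union_comm D', hDD]
        rintro y (hy | rfl) (rfl | rfl)
        · exact hunion.le (Or.inr hy) (Or.inl rfl)
        · exact disjoint_left.1 hUV hq hy
        · exact hab rfl
        · exact hqb rfl
      · exact hV.isPreconnected.subset_closure subset_union_left
          (union_subset subset_closure (singleton_subset_iff.2 hVb))
    have hxD' : x ∉ D' := disjoint_left.1 hdis hx
    have : x ∈ ({a, b}ᶜ : Set X) := by
      rintro (rfl | rfl)
      · exact hDD.le (Or.inl hx) (Or.inl rfl)
      · exact hxD' hb
    rw [← hunion] at this
    exact this.resolve_right fun h => hxD' (hVsub (Or.inl h))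
  obtain ⟨D, D', hD, hD', hDc, hDc', hdis, hDD, hcl, hcl'⟩ := exists_components_compl_pair H hqa
  have hb : b ∈ D ∪ D' := by
    rw [hDD]
    rintro (h | h)
    · exact hab h.symm
    · exact hqb h
  rcases hb with hb | hb
  · have hDD' := (union_comm D' D).trans hDD
    exact ⟨D', D, hD', hD, hDc', hdis.symm, hDD', hcl', hb, main _ _ hD' hD hdis.symm hDD' hb⟩
  · exact ⟨D, D', hD, hD', hDc, hdis, hDD, hcl, hb, main _ _ hD hD' hdis hDD hb⟩

lemma exists_separation_of_mem
    (H : ∀ A : Set X, IsClosed A → IsConnected A → IsPreconnected Aᶜ) {a b q : X} {U V : Set X}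
    (hUo : IsOpen U) (hVo : IsOpen V) (hUV : Disjoint U V) (hV : IsConnected V)
    (hunion : U ∪ V = {a, b}ᶜ) (hVa : a ∈ closure V) (hVb : b ∈ closure V) (hq : q ∈ U)
    (hab : a ≠ b) :
    ∃ P Q : Set X, IsClosed P ∧ IsClosed Q ∧ IsPreconnected P ∧ IsPreconnected Q ∧
      P ∪ Q = U ∪ {a, b} ∧ P ∩ Q = {q} ∧ a ∈ P ∧ b ∈ Q := by
  obtain ⟨D, D', hD, hD', hDc, hdD, hDD, hDcl, hbD, hDU⟩ :=
    exists_component_subset H hUV hV hunion hVb hq hab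
  obtain ⟨E, E', hE, hE', hEc, hdE, hEE, hEcl, haE, hEU⟩ :=
    exists_component_subset H hUV hV (by rwa [pair_comm]) hVa hq hab.symm
  have hq' : q ∉ ({a, b} : Set X) := fun h => (hunion.le (Or.inl hq)) h
  have haU : a ∉ U := fun h => hunion.le (Or.inl h) (Or.inl rfl)
  have hbU : b ∉ U := fun h => hunion.le (Or.inl h) (Or.inr rfl)
  have haV : a ∉ V := fun h => hunion.le (Or.inr h) (Or.inl rfl)
  have hbV : b ∉ V := fun h => hunion.le (Or.inr h) (Or.inr rfl)
  have hqV : q ∉ V := disjoint_left.1 hUV hq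
  have hqD : q ∉ D := fun h => hDD.le (Or.inl h) (Or.inr rfl)
  have hqE : q ∉ E := fun h => hEE.le (Or.inl h) (Or.inr rfl)
  have hDE : D ∪ {a} ⊆ E' := by
    refine IsPreconnected.subset_left_of_subset_union hE' hE hdE.symm ?_ ⟨a, Or.inr rfl, haE⟩ ?_
    · rw [union_comm E', hEE]
      rintro y (hy | rfl) (rfl | rfl)
      · exact hbU (hDU hy)
      · exact hqD hy
      · exact hab rfl
      · exact haU hq
    · refine hDc.isPreconnected.subset_closure subset_union_left ?_
      rw [hDcl]
      exact union_subset_union_right _ (by simp)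
  have hdis : Disjoint D E :=
    disjoint_left.2 fun x hx hx' => disjoint_left.1 hdE hx' (hDE (Or.inl hx))
  have hqDcl : q ∈ closure D := by rw [hDcl]; simp
  have hqEcl : q ∈ closure E := by rw [hEcl]; simp
  refine ⟨closure D, closure E, isClosed_closure, isClosed_closure, hDc.isPreconnected.closure,
    hEc.isPreconnected.closure, ?_, ?_, by rw [hDcl]; simp, by rw [hEcl]; simp⟩
  · apply Subset.antisymm
    · rw [hDcl, hEcl]
      rintro x ((hx | rfl | rfl) | (hx | rfl | rfl))
      · exact Or.inl (hDU hx)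
      · simp
      · exact Or.inl hq
      · exact Or.inl (hEU hx)
      · simp
      · exact Or.inl hq
    · rintro x (hx | hx)
      · by_contra hxT
        have hT : IsConnected (closure D ∪ closure E) :=
          IsConnected.union ⟨q, hqDcl, hqEcl⟩ hDc.closure hEc.closure
        have haT : a ∈ closure D ∪ closure E := Or.inl (by rw [hDcl]; simp)
        have hbT : b ∈ closure D ∪ closure E := Or.inr (by rw [hEcl]; simp)
        obtain ⟨v, hv⟩ := hV.nonempty
        have hvT : v ∉ closure D ∪ closure E := by
          rw [hDcl, hEcl]
          rintro ((h | rfl | rfl) | (h | rfl | rfl))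
          · exact disjoint_left.1 hUV (hDU h) hv
          · exact haV hv
          · exact hqV hv
          · exact disjoint_left.1 hUV (hEU h) hv
          · exact hbV hv
          · exact hqV hv
        obtain ⟨z, -, hz⟩ := H _ (isClosed_closure.union isClosed_closure) hT U V hUo hVo (by
          rw [hunion]
          rintro y hy (rfl | rfl)
          · exact hy haT
          · exact hy hbT) ⟨x, hxT, hx⟩ ⟨v, hvT, hv⟩
        exact disjoint_left.1 hUV hz.1 hz.2
      · rcases hx with rfl | rfl
        · exact Or.inl (by rw [hDcl]; simp)
        · exact Or.inr (by rw [hEcl]; simp)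
  · apply Subset.antisymm
    · rw [hDcl, hEcl]
      rintro x ⟨(hx | rfl | hx), (hx' | rfl | hx')⟩
      · exact absurd hx' (disjoint_left.1 hdis hx)
      · exact absurd (hDU hx) hbU
      · exact hx'
      · exact absurd (hEU hx') haU
      · exact absurd rfl hab
      · exact hx'
      all_goals exact hx
    · exact singleton_subset_iff.2 ⟨hqDcl, hqEcl⟩

lemma exists_arc_of_component
    (H : ∀ A : Set X, IsClosed A → IsConnected A → IsPreconnected Aᶜ) {a b : X} {U V : Set X}
    (hUo : IsOpen U) (hVo : IsOpen V) (hUV : Disjoint U V) (hU : IsConnected U)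
    (hV : IsConnected V) (hunion : U ∪ V = {a, b}ᶜ) (hUcl : closure U = U ∪ {a, b})
    (hVcl : closure V = V ∪ {a, b}) (hab : a ≠ b) :
    ∃ f : X → ℝ, ContinuousOn f (closure U) ∧ InjOn f (closure U) ∧
      f '' closure U = Icc 0 1 ∧ f a = 0 ∧ f b = 1 := by
  have haU : a ∈ closure U := by rw [hUcl]; simp
  have hbU : b ∈ closure U := by rw [hUcl]; simp
  have : CompactSpace (closure U) := isCompact_iff_compactSpace.1 isClosed_closure.isCompact
  have : PreconnectedSpace (closure U) := Subtype.preconnectedSpace hU.isPreconnected.closure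
  have hsep : ∀ q ∈ closure U, ∃ P Q : Set X, IsClosed P ∧ IsClosed Q ∧ IsPreconnected P ∧
      IsPreconnected Q ∧ P ∪ Q = closure U ∧ P ∩ Q = {q} ∧ a ∈ P ∧ b ∈ Q := by
    intro q hq
    have hq' := hUcl ▸ hq
    rcases hq' with hq' | rfl | rfl
    · rw [hUcl]
      exact exists_separation_of_mem H hUo hVo hUV hV hunion (by rw [hVcl]; simp)
        (by rw [hVcl]; simp) hq' hab
    · exact ⟨{q}, closure U, isClosed_singleton, isClosed_closure, isPreconnected_singleton,
        hU.isPreconnected.closure, union_eq_right.2 (singleton_subset_iff.2 hq),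
        inter_eq_left.2 (singleton_subset_iff.2 hq), rfl, hbU⟩
    · exact ⟨closure U, {q}, isClosed_closure, isClosed_singleton, hU.isPreconnected.closure,
        isPreconnected_singleton, union_eq_left.2 (singleton_subset_iff.2 hq),
        inter_eq_right.2 (singleton_subset_iff.2 hq), haU, rfl⟩
  obtain ⟨f, hf, hinj, hr, hfa, hfb⟩ := exists_arc_parametrization
    (a := (⟨a, haU⟩ : closure U)) (b := ⟨b, hbU⟩) (fun h => hab (congrArg Subtype.val h)) (by
      rintro ⟨q, hq⟩
      obtain ⟨P, Q, hP, hQ, hPc, hQc, hPQ, hI, ha, hb⟩ := hsep q hq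
      refine ⟨Subtype.val ⁻¹' P, Subtype.val ⁻¹' Q, hP.preimage continuous_subtype_val,
        hQ.preimage continuous_subtype_val, ?_, ?_, ?_, ?_, ha, hb⟩
      · refine Topology.IsInducing.subtypeVal.isPreconnected_image.1 ?_
        rwa [Subtype.image_preimage_coe, inter_eq_right.2 (hPQ ▸ subset_union_left)]
      · refine Topology.IsInducing.subtypeVal.isPreconnected_image.1 ?_
        rwa [Subtype.image_preimage_coe, inter_eq_right.2 (hPQ ▸ subset_union_right)]
      · rw [← preimage_union, hPQ]
        exact Subtype.coe_preimage_self _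
      · rw [← preimage_inter, hI]
        ext x
        simp [Subtype.ext_iff])
  classical
  set F : X → ℝ := fun x => if h : x ∈ closure U then f ⟨x, h⟩ else 0 with hF
  have hFf : ∀ x : closure U, F x = f x := fun x => by simp [hF]
  have hFr : (closure U).domRestrict F = f := funext hFf
  refine ⟨F, ?_, ?_, ?_, (hFf ⟨a, haU⟩).trans hfa, (hFf ⟨b, hbU⟩).trans hfb⟩
  · rwa [continuousOn_iff_continuous_domRestrict, hFr]
  · rwa [injOn_iff_injective, hFr]
  · rw [← range_domRestrict, hFr, hr]

theorem nonempty_homeomorph_circle [Nontrivial X]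
    (H : ∀ A : Set X, IsClosed A → IsConnected A → IsPreconnected Aᶜ) :
    Nonempty (X ≃ₜ Circle) := by
  classical
  obtain ⟨a, b, hab⟩ := exists_pair_ne X
  obtain ⟨U, V, hUo, hVo, hU, hV, hUV, hunion, hUcl, hVcl⟩ := exists_components_compl_pair H hab
  obtain ⟨f, hf, hfi, hfr, hfa, hfb⟩ :=
    exists_arc_of_component H hUo hVo hUV hU hV hunion hUcl hVcl hab
  obtain ⟨g, hg, hgi, hgr, hga, hgb⟩ :=
    exists_arc_of_component H hVo hUo hUV.symm hV hU ((union_comm V U).trans hunion) hVcl hUcl hab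
  have hpi := Real.pi_pos
  have hVmem : ∀ {x}, x ∉ closure U → x ∈ V := by
    intro x hx
    have : x ∈ U ∪ V := hunion ▸ fun h => hx (hUcl ▸ Or.inr h)
    exact this.resolve_left fun h => hx (subset_closure h)
  have hcover : closure U ∪ closure V = univ := eq_univ_of_forall fun x => by
    by_cases h : x ∈ closure U
    · exact Or.inl h
    · exact Or.inr (subset_closure (hVmem h))
  have hinter : ∀ {x}, x ∈ closure U → x ∈ closure V → x = a ∨ x = b := by
    intro x hx hx'
    rw [hUcl] at hx
    rw [hVcl] at hx'
    rcases hx with hx | hx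
    · rcases hx' with hx' | hx'
      · exact absurd hx' (disjoint_left.1 hUV hx)
      · exact hx'
    · exact hx
  have hfI : ∀ {x}, x ∈ closure U → 0 ≤ f x ∧ f x ≤ 1 := fun {x} hx =>
    hfr.le (mem_image_of_mem f hx)
  have haV : a ∈ closure V := by rw [hVcl]; simp
  have hbV : b ∈ closure V := by rw [hVcl]; simp
  have haU : a ∈ closure U := by rw [hUcl]; simp
  have hbU : b ∈ closure U := by rw [hUcl]; simp
  have hgI : ∀ {x}, x ∉ closure U → 0 < g x ∧ g x < 1 := by
    intro x hx
    have hxV := subset_closure (hVmem hx)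
    have h01 : 0 ≤ g x ∧ g x ≤ 1 := hgr.le (mem_image_of_mem g hxV)
    refine ⟨h01.1.lt_of_ne fun h => hx ?_, h01.2.lt_of_ne fun h => hx ?_⟩
    · rwa [← hgi haV hxV (hga.trans h)]
    · rwa [← hgi hbV hxV (hgb.trans h.symm)]
  set θ : X → ℝ := fun x => if x ∈ closure U then Real.pi * f x else -(Real.pi * g x) with hθ
  have hθU : ∀ {x}, x ∈ closure U → θ x = Real.pi * f x := fun h => if_pos h
  have hθV : ∀ {x}, x ∉ closure U → θ x = -(Real.pi * g x) := fun h => if_neg h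
  have hθmem : ∀ x, -Real.pi < θ x ∧ θ x ≤ Real.pi := by
    intro x
    by_cases h : x ∈ closure U
    · rw [hθU h]
      have := hfI h
      constructor <;> nlinarith
    · rw [hθV h]
      have := hgI h
      constructor <;> nlinarith
  have hθinj : Function.Injective θ := by
    intro x y hxy
    by_cases hx : x ∈ closure U <;> by_cases hy : y ∈ closure U
    · rw [hθU hx, hθU hy] at hxy
      exact hfi hx hy (mul_left_cancel₀ hpi.ne' hxy)
    · rw [hθU hx, hθV hy] at hxy
      have h1 := hfI hx
      have h2 := hgI hy
      nlinarith
    · rw [hθV hx, hθU hy] at hxy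
      have h1 := hfI hy
      have h2 := hgI hx
      nlinarith
    · rw [hθV hx, hθV hy, neg_inj] at hxy
      exact hgi (subset_closure (hVmem hx)) (subset_closure (hVmem hy))
        (mul_left_cancel₀ hpi.ne' hxy)
  have hθsurj : ∀ t, -Real.pi < t → t ≤ Real.pi → ∃ x, θ x = t := by
    intro t h1 h2
    rcases le_or_gt 0 t with h0 | h0
    · obtain ⟨x, hx, hxt⟩ := hfr.ge
        (show t / Real.pi ∈ Icc (0 : ℝ) 1 from ⟨by positivity, (div_le_one hpi).2 h2⟩)
      refine ⟨x, ?_⟩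
      rw [hθU hx, hxt]
      field_simp
    · have hlt : -t / Real.pi < 1 := (div_lt_one hpi).2 (by linarith)
      have hpos : 0 < -t / Real.pi := div_pos (by linarith) hpi
      obtain ⟨x, hx, hxt⟩ := hgr.ge (show -t / Real.pi ∈ Icc (0 : ℝ) 1 from ⟨hpos.le, hlt.le⟩)
      have hxU : x ∉ closure U := by
        intro h
        rcases hinter h hx with rfl | rfl <;> linarith
      refine ⟨x, ?_⟩
      rw [hθV hxU, hxt]
      field_simp
  have hcont : Continuous fun x => Circle.exp (θ x) := by
    rw [← continuousOn_univ, ← hcover]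
    refine ContinuousOn.union_of_isClosed ?_ ?_ isClosed_closure isClosed_closure
    · refine ContinuousOn.congr (f := fun x => Circle.exp (Real.pi * f x))
        (Circle.exp.continuous.comp_continuousOn (continuousOn_const.mul hf))
        fun x hx => ?_
      simp only [hθU hx]
    · refine ContinuousOn.congr (f := fun x => Circle.exp (-(Real.pi * g x)))
        (Circle.exp.continuous.comp_continuousOn (continuousOn_const.mul hg).neg)
        fun x hx => ?_
      by_cases hxU : x ∈ closure U
      · rcases hinter hxU hx with rfl | rfl
        · simp [hθU hxU, hfa, hga]
        · simp only [hθU hxU, hfb, hgb, mul_one]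
          exact Circle.exp_eq_exp.2 ⟨1, by push_cast; ring⟩
      · simp only [hθV hxU]
  have hbij : Function.Bijective fun x => Circle.exp (θ x) := by
    constructor
    · intro x y hxy
      have := congrArg (fun z : Circle => (z : ℂ).arg) hxy
      simp only [Circle.arg_exp (hθmem _).1 (hθmem _).2] at this
      exact hθinj this
    · intro z
      obtain ⟨x, hx⟩ := hθsurj (z : ℂ).arg (Complex.neg_pi_lt_arg _) (Complex.arg_le_pi _)
      exact ⟨x, by simp only [hx, Circle.exp_arg]⟩
  exact ⟨Continuous.homeoOfEquivCompactToT2 (f := Equiv.ofBijective _ hbij) hcont⟩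

end SubcontinuumComplement

lemma Circle.isPreconnected_compl_of_notMem {A : Set Circle} (hA : IsCompact A)
    (hAc : IsConnected A) (h1 : Circle.exp Real.pi ∉ A) : IsPreconnected Aᶜ := by
  have hpi := Real.pi_pos
  have hlt : ∀ z ∈ A, (z : ℂ).arg < Real.pi := fun z hz =>
    (Complex.arg_le_pi _).lt_of_ne fun h => h1 (by rwa [← h, Circle.exp_arg])
  have hcont : ContinuousOn (fun z : Circle => (z : ℂ).arg) A := fun z hz =>
    (ContinuousAt.comp (f := fun z : Circle => (z : ℂ)) (Complex.continuousAt_arg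
      (Complex.mem_slitPlane_iff_arg.2 ⟨(hlt z hz).ne, Circle.coe_ne_zero z⟩))
      continuous_subtype_val.continuousAt).continuousWithinAt
  have hI := eq_Icc_of_connected_compact (hAc.image _ hcont) (hA.image_of_continuousOn hcont)
  set c := sInf ((fun z : Circle => (z : ℂ).arg) '' A)
  set d := sSup ((fun z : Circle => (z : ℂ).arg) '' A)
  have hcd : c ≤ d := nonempty_Icc.1 (hI ▸ hAc.nonempty.image _)
  obtain ⟨x, hx, hxc⟩ := hI.ge (left_mem_Icc.2 hcd)
  obtain ⟨y, hy, hyd⟩ := hI.ge (right_mem_Icc.2 hcd)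
  have hc : -Real.pi < c := hxc ▸ Complex.neg_pi_lt_arg _
  have hd : d < Real.pi := hyd ▸ hlt y hy
  have hmem : ∀ z : Circle, z ∈ A ↔ (z : ℂ).arg ∈ Icc c d := by
    intro z
    rw [← hI]
    refine ⟨fun h => ⟨z, h, rfl⟩, ?_⟩
    rintro ⟨w, hw, hwz⟩
    rwa [← Circle.injective_arg hwz]
  have : Aᶜ = Circle.exp '' Ioo d (c + 2 * Real.pi) := by
    ext z
    rw [mem_compl_iff, hmem]
    constructor
    · intro hz
      have hz1 := Complex.neg_pi_lt_arg (z : ℂ)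
      have hz2 := Complex.arg_le_pi (z : ℂ)
      rcases lt_or_ge d (z : ℂ).arg with h | h
      · exact ⟨_, ⟨h, by linarith⟩, Circle.exp_arg z⟩
      · have hzc : (z : ℂ).arg < c := by
          by_contra! h'
          exact hz ⟨h', h⟩
        exact ⟨(z : ℂ).arg + 2 * Real.pi, ⟨by linarith, by linarith⟩, by
          rw [Circle.exp_add_two_pi, Circle.exp_arg]⟩
    · rintro ⟨t, ⟨ht1, ht2⟩, rfl⟩ ⟨h1, h2⟩
      rcases le_or_gt t Real.pi with h | h
      · rw [Circle.arg_exp (by linarith) h] at h2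
        linarith
      · have : Circle.exp t = Circle.exp (t - 2 * Real.pi) := by
          rw [← Circle.exp_add_two_pi (t - 2 * Real.pi), sub_add_cancel]
        rw [this, Circle.arg_exp (by linarith) (by linarith)] at h1
        linarith
  rw [this]
  exact isPreconnected_Ioo.image _ Circle.exp.continuous.continuousOn

lemma isPreconnected_compl_of_homeomorph_circle {X : Type*} [TopologicalSpace X]
    (e : X ≃ₜ Circle) {A : Set X} (hA : IsCompact A) (hAc : IsConnected A) :
    IsPreconnected Aᶜ := by
  rcases Aᶜ.eq_empty_or_nonempty with h | ⟨p, hp⟩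
  · rw [h]
    exact isPreconnected_empty
  · let e' : X ≃ₜ Circle := e.trans (Homeomorph.mulLeft (Circle.exp Real.pi * (e p)⁻¹))
    have hp' : e' p = Circle.exp Real.pi := by simp [e']
    have := Circle.isPreconnected_compl_of_notMem (hA.image e'.continuous)
      (hAc.image _ e'.continuous.continuousOn) (by
        rw [← hp', e'.injective.mem_set_image]
        exact hp)
    rwa [← image_compl_eq e'.bijective, e'.isPreconnected_image] at this

/-- For a locally connected continuum X, NC*(X) = C(X) iff X is
homeomorphic to the unit circle. -/
theorem stmt2 {X : Type*} [MetricSpace X] [CompactSpace X] [ConnectedSpace X] [Nontrivial X]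
    [LocallyConnectedSpace X] :
    (∀ A : NonemptyCompacts X, IsConnected (A : Set X) → IsPreconnected ((A : Set X)ᶜ)) ↔
      Nonempty (X ≃ₜ Circle) := by
  constructor
  · intro H
    exact nonempty_homeomorph_circle fun A hA hAc =>
      H ⟨⟨A, hA.isCompact⟩, hAc.nonempty⟩ hAc
  · rintro ⟨e⟩ A hA
    exact isPreconnected_compl_of_homeomorph_circle e A.isCompact hA
end
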